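/- Let R be a Hecke operator on V, set n = dim_K V, assume the quantum integers [k]_q = 1 + q + ⋯ + q^{k−1} are nonzero in K for every integer k ≥ 1, and suppose R is an even Hecke operator of rank equal to n, i.e. λ_n = 1 and λ_k = 0 for all k > n. Then λ_k = C(n, k) for all k ≥ 0 (i.e. P_Λ(t) = (1+t)^n) and s_k = C(n+k−1, k) for all k ≥ 0 (i.e. P_S(t) = (1−t)^{−n}). (Corollary 3.3) -/

import Mathlib

open TensorProduct

/-- The Yang–Baxter equation for an operator `R` on `V ⊗ V`, stated on `(V ⊗ V) ⊗ V`: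
`(R ⊗ 1)(1 ⊗ R)(R ⊗ 1) = (1 ⊗ R)(R ⊗ 1)(1 ⊗ R)`, where `1 ⊗ R` is transported along
the associator. -/
def YangBaxter (K : Type*) [Field K] (V : Type*) [AddCommGroup V] [Module K V]
    (R : V ⊗[K] V →ₗ[K] V ⊗[K] V) : Prop :=
  let R₁ : (V ⊗[K] V) ⊗[K] V →ₗ[K] (V ⊗[K] V) ⊗[K] V := LinearMap.rTensor V R
  let R₂ : (V ⊗[K] V) ⊗[K] V →ₗ[K] (V ⊗[K] V) ⊗[K] V :=
    (TensorProduct.assoc K V V V).symm.toLinearMap ∘ₗ LinearMap.lTensor V R ∘ₗ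
      (TensorProduct.assoc K V V V).toLinearMap
  R₁ ∘ₗ R₂ ∘ₗ R₁ = R₂ ∘ₗ R₁ ∘ₗ R₂

/-- A Hecke operator on `V` for the parameter `q`: the Yang–Baxter equation together
with the Hecke equation `(R + 1)(R − q) = 0`. -/
def IsHecke (K : Type*) [Field K] (V : Type*) [AddCommGroup V] [Module K V]
    (q : K) (R : V ⊗[K] V →ₗ[K] V ⊗[K] V) : Prop :=
  YangBaxter K V R ∧ (R + LinearMap.id) ∘ₗ (R - q • LinearMap.id) = 0

/-- The multiplication map `V ⊗ V → T(V)` of the tensor algebra. -/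
noncomputable def quadMul (K : Type*) [Field K] (V : Type*) [AddCommGroup V] [Module K V] :
    V ⊗[K] V →ₗ[K] TensorAlgebra K V :=
  LinearMap.mul' K (TensorAlgebra K V) ∘ₗ
    TensorProduct.map (TensorAlgebra.ι K) (TensorAlgebra.ι K)

/-- The relation on `T(V)` identifying the image of `W ⊆ V ⊗ V` with zero; quotienting
by (the two-sided ideal generated by) it yields the quadratic algebra `T(V)/⟨W⟩`. -/
def quadRel (K : Type*) [Field K] (V : Type*) [AddCommGroup V] [Module K V]
    (W : Submodule K (V ⊗[K] V)) : TensorAlgebra K V → TensorAlgebra K V → Prop :=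
  fun a b => b = 0 ∧ ∃ w ∈ W, a = quadMul K V w

/-- The dimension of the `n`-th homogeneous component of the quadratic algebra
`T(V)/⟨W⟩`, realised as the image of the degree-`n` component of `T(V)` in the
quotient algebra. -/
noncomputable def quadDim (K : Type*) [Field K] (V : Type*) [AddCommGroup V] [Module K V]
    (W : Submodule K (V ⊗[K] V)) (n : ℕ) : ℕ :=
  Module.finrank K
    (Submodule.map (RingQuot.mkAlgHom K (quadRel K V W)).toLinearMap
      (LinearMap.range (TensorAlgebra.ι K (M := V)) ^ n))

/-- `λ_n`, the dimension of the `n`-th homogeneous component of `Λ = T(V)/⟨Im(R+1)⟩`. -/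
noncomputable def lambdaDim (K : Type*) [Field K] (V : Type*) [AddCommGroup V] [Module K V]
    (R : V ⊗[K] V →ₗ[K] V ⊗[K] V) (n : ℕ) : ℕ :=
  quadDim K V (LinearMap.range (R + LinearMap.id)) n

/-- `s_n`, the dimension of the `n`-th homogeneous component of `S = T(V)/⟨Im(R−q)⟩`. -/
noncomputable def sDim (K : Type*) [Field K] (V : Type*) [AddCommGroup V] [Module K V]
    (q : K) (R : V ⊗[K] V →ₗ[K] V ⊗[K] V) (n : ℕ) : ℕ :=
  quadDim K V (LinearMap.range (R - q • LinearMap.id)) n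


namespace HeckeProof

section Abstract
variable {K : Type*} [Field K] {X : Type*} [AddCommGroup X] [Module K X]

/-- The quantum integer `[k]_q`. -/
def qn (q : K) (k : ℕ) : K := ∑ i ∈ Finset.range k, q ^ i

theorem qn_zero (q : K) : qn q 0 = 0 := by simp [qn]
theorem qn_one (q : K) : qn q 1 = 1 := by simp [qn]
theorem qn_succ (q : K) (k : ℕ) : qn q (k + 1) = qn q k + q ^ k := by
  simp [qn, Finset.sum_range_succ]

theorem qn_geom (q : K) (k : ℕ) : (q - 1) * qn q k = q ^ k - 1 := by
  induction k with
  | zero => simp [qn_zero]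
  | succ k ih => rw [qn_succ, mul_add, ih]; ring

/-- The Hecke relations for a family of operators. -/
structure HR (q : K) (T : ℕ → Module.End K X) : Prop where
  quad : ∀ i x, T i (T i x) = (q - 1) • T i x + q • x
  braid : ∀ i x, T i (T (i + 1) (T i x)) = T (i + 1) (T i (T (i + 1) x))
  comm : ∀ i j x, i + 2 ≤ j → T i (T j x) = T j (T i x)

/-- Sum of signed coset representatives. -/
noncomputable def cc (q : K) (T : ℕ → Module.End K X) : ℕ → Module.End K X
  | 0 => 1
  | j + 1 => q ^ (j + 1) • 1 - cc q T j * T j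

/-- The antisymmetrizer. -/
noncomputable def asym (q : K) (T : ℕ → Module.End K X) : ℕ → Module.End K X
  | 0 => 1
  | j + 1 => (qn q (j + 1))⁻¹ • (cc q T j * asym q T j)

variable {q : K} {T : ℕ → Module.End K X}

theorem cc_zero_apply (x : X) : cc q T 0 x = x := rfl
theorem cc_succ_apply (j : ℕ) (x : X) :
    cc q T (j + 1) x = q ^ (j + 1) • x - cc q T j (T j x) := by
  simp [cc]
theorem asym_zero_apply (x : X) : asym q T 0 x = x := rfl
theorem asym_succ_apply (j : ℕ) (x : X) :
    asym q T (j + 1) x = (qn q (j + 1))⁻¹ • cc q T j (asym q T j x) := by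
  simp [asym]

theorem asym_one_apply (x : X) : asym q T 1 x = x := by
  rw [asym_succ_apply, asym_zero_apply, cc_zero_apply, qn_one, inv_one, one_smul]

/-- Naturality. -/
theorem cc_nat {Y : Type*} [AddCommGroup Y] [Module K Y] {T' : ℕ → Module.End K Y}
    (S : Submodule K Y) (Ψ : Y →ₗ[K] X) (j : ℕ)
    (h : ∀ m, m < j → ∀ y ∈ S, T' m y ∈ S ∧ T m (Ψ y) = Ψ (T' m y)) :
    ∀ y ∈ S, cc q T' j y ∈ S ∧ cc q T j (Ψ y) = Ψ (cc q T' j y) := by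
  induction j with
  | zero => intro y hy; exact ⟨hy, rfl⟩
  | succ j ih =>
    intro y hy
    obtain ⟨h1, h2⟩ := h j (Nat.lt_succ_self j) y hy
    obtain ⟨h3, h4⟩ := ih (fun m hm => h m (by omega)) _ h1
    rw [cc_succ_apply, cc_succ_apply, h2, h4]
    exact ⟨S.sub_mem (S.smul_mem _ hy) h3, by simp⟩

theorem asym_nat {Y : Type*} [AddCommGroup Y] [Module K Y] {T' : ℕ → Module.End K Y}
    (S : Submodule K Y) (Ψ : Y →ₗ[K] X) (j : ℕ)
    (h : ∀ m, m + 1 < j → ∀ y ∈ S, T' m y ∈ S ∧ T m (Ψ y) = Ψ (T' m y)) :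
    ∀ y ∈ S, asym q T' j y ∈ S ∧ asym q T j (Ψ y) = Ψ (asym q T' j y) := by
  induction j with
  | zero => intro y hy; exact ⟨hy, rfl⟩
  | succ j ih =>
    intro y hy
    obtain ⟨h3, h4⟩ := ih (fun m hm => h m (by omega)) _ hy
    obtain ⟨h5, h6⟩ := cc_nat (q := q) S Ψ j (fun m hm => h m (by omega)) _ h3
    rw [asym_succ_apply, asym_succ_apply, h4, h6]
    exact ⟨S.smul_mem _ h5, by simp⟩

theorem cc_comm (Ψ : Module.End K X) (j : ℕ)
    (h : ∀ m, m < j → ∀ y, T m (Ψ y) = Ψ (T m y)) (y : X) :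
    cc q T j (Ψ y) = Ψ (cc q T j y) :=
  (cc_nat (q := q) (T' := T) ⊤ Ψ j (fun m hm y _ => ⟨trivial, h m hm y⟩) y trivial).2

theorem asym_comm (Ψ : Module.End K X) (j : ℕ)
    (h : ∀ m, m + 1 < j → ∀ y, T m (Ψ y) = Ψ (T m y)) (y : X) :
    asym q T j (Ψ y) = Ψ (asym q T j y) :=
  (asym_nat (q := q) (T' := T) ⊤ Ψ j (fun m hm y _ => ⟨trivial, h m hm y⟩) y trivial).2

theorem asym_mem (S : Submodule K X) (j : ℕ)
    (h : ∀ m, m + 1 < j → ∀ y ∈ S, T m y ∈ S) (y : X) (hy : y ∈ S) : asym q T j y ∈ S :=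
  (asym_nat (q := q) (T := T) (T' := T) S LinearMap.id j
    (fun m hm y hy => ⟨h m hm y hy, rfl⟩) y hy).1

theorem kill_cc (H : HR q T) (j : ℕ) : ∀ y, (∀ m, m + 1 < j → T m y = -y) →
    ∀ m, m < j → T m (cc q T j y) = - cc q T j y := by
  induction j with
  | zero => intro y _ m hm; omega
  | succ j ih =>
    intro y hy m hm
    rw [cc_succ_apply]
    rcases Nat.lt_succ_iff_lt_or_eq.mp hm with h | h
    · have := ih (T j y) (fun m hm => by
        rw [H.comm m j y (by omega), hy m (by omega), map_neg]) m h
      rw [map_sub, map_smul, this, hy m (by omega)]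
      module
    · subst h
      cases m with
      | zero =>
        rw [cc_zero_apply, map_sub, map_smul, H.quad]
        simp only [zero_add, pow_one]
        module
      | succ j =>
        have hc : ∀ z, T (j + 1) (cc q T j z) = cc q T j (T (j + 1) z) := fun z =>
          (cc_comm (T (j + 1)) j (fun m hm y => H.comm m (j + 1) y (by omega)) z).symm
        have e1 : T (j + 1) (cc q T (j + 1) (T (j + 1) y)) =
            q ^ (j + 2) • T (j + 1) y + q ^ (j + 2) • y - cc q T (j + 1) (T (j + 1) y) := by
          have hb : T (j + 1) (T j (T (j + 1) y)) = - T j (T (j + 1) y) := by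
            rw [← H.braid, hy j (by omega), map_neg, map_neg]
          rw [cc_succ_apply, map_sub, map_smul, hc, hb, H.quad, map_neg]
          module
        rw [map_sub, map_smul, e1]
        module


theorem cc_fix (j : ℕ) : ∀ y : X, (∀ m, m < j → T m y = -y) → cc q T j y = qn q (j + 1) • y := by
  induction j with
  | zero => intro y _; simp [cc_zero_apply, qn_one]
  | succ j ih =>
    intro y hy
    rw [cc_succ_apply, hy j (by omega), map_neg, ih y (fun m hm => hy m (by omega)),
      qn_succ q (j + 1)]
    module

theorem asym_fix (hq : ∀ k, 1 ≤ k → qn q k ≠ 0) (j : ℕ) : ∀ y : X, (∀ m, m + 1 < j → T m y = -y) → asym q T j y = y := by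
  induction j with
  | zero => intro y _; rfl
  | succ j ih =>
    intro y hy
    rw [asym_succ_apply, ih y (fun m hm => hy m (by omega)),
      cc_fix j y (fun m hm => hy m (by omega)), inv_smul_smul₀ (hq _ (by omega))]

theorem kill_asym (H : HR q T) (j : ℕ) (y : X) :
    ∀ m, m + 1 < j → T m (asym q T j y) = - asym q T j y := by
  induction j with
  | zero => intro m hm; omega
  | succ j ih =>
    intro m hm
    rw [asym_succ_apply, map_smul, kill_cc H j _ ih m (by omega), smul_neg]

variable {Q : Type*} [AddCommGroup Q] [Module K Q]

theorem cc_fix_right (z : X →ₗ[K] Q) (j : ℕ) (hz : ∀ m, m < j → ∀ y, z (T m y) = - z y) :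
    ∀ y, z (cc q T j y) = qn q (j + 1) • z y := by
  induction j with
  | zero => intro y; simp [cc_zero_apply, qn_one]
  | succ j ih =>
    intro y
    rw [cc_succ_apply, map_sub, map_smul, ih (fun m hm => hz m (by omega)), hz j (by omega),
      qn_succ q (j + 1)]
    module

theorem asym_fix_right (hq : ∀ k, 1 ≤ k → qn q k ≠ 0) (z : X →ₗ[K] Q) (j : ℕ) (hz : ∀ m, m + 1 < j → ∀ y, z (T m y) = - z y) :
    ∀ y, z (asym q T j y) = z y := by
  induction j with
  | zero => intro y; rfl
  | succ j ih =>
    intro y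
    rw [asym_succ_apply, map_smul, cc_fix_right z j (fun m hm => hz m (by omega)),
      ih (fun m hm => hz m (by omega)), inv_smul_smul₀ (hq _ (by omega))]

/-- The family acting on `Hom(X, Q)` by precomposition. -/
def Top (Q : Type*) [AddCommGroup Q] [Module K Q] (T : ℕ → Module.End K X) :
    ℕ → Module.End K (X →ₗ[K] Q) := fun m => LinearMap.lcomp K Q (T m)

theorem Top_HR (H : HR q T) : HR q (Top Q T) where
  quad i z := by
    ext x
    simp [Top, H.quad]
  braid i z := by
    ext x
    simp [Top, H.braid]
  comm i j z h := by
    ext x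
    simp [Top, H.comm i j _ h]

theorem Top_cc_fix (j : ℕ) (y : X) (hy : ∀ m, m < j → T m y = -y) : ∀ z : X →ₗ[K] Q,
    cc q (Top Q T) j z y = qn q (j + 1) • z y := by
  induction j with
  | zero => intro y; simp [cc_zero_apply, qn_one]
  | succ j ih =>
    intro z
    rw [cc_succ_apply, LinearMap.sub_apply, ih (fun m hm => hy m (by omega)),
      qn_succ q (j + 1)]
    simp only [Top, LinearMap.lcomp_apply, LinearMap.smul_apply, hy j (by omega), map_neg]
    module

theorem Top_asym_fix (hq : ∀ k, 1 ≤ k → qn q k ≠ 0) (j : ℕ) (y : X) (hy : ∀ m, m + 1 < j → T m y = -y) : ∀ z : X →ₗ[K] Q,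
    asym q (Top Q T) j z y = z y := by
  induction j with
  | zero => intro y; rfl
  | succ j ih =>
    intro z
    rw [asym_succ_apply, LinearMap.smul_apply, Top_cc_fix j y (fun m hm => hy m (by omega)),
      ih (fun m hm => hy m (by omega)), inv_smul_smul₀ (hq _ (by omega))]

theorem asym_eq_Top (hq : ∀ k, 1 ≤ k → qn q k ≠ 0) (H : HR q T) (j : ℕ) (y : X) :
    asym q (Top X T) j LinearMap.id y = asym q T j y := by
  have h1 := Top_asym_fix (Q := X) hq j (asym q T j y) (kill_asym H j y) LinearMap.id
  have h2 := asym_fix_right hq (asym q (Top X T) j LinearMap.id) j (fun m hm y => by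
    have := kill_asym (Top_HR (Q := X) H) j LinearMap.id m hm
    exact congrArg (fun f => f y) this) y
  rw [← h2, h1]; rfl

theorem asym_kill_right (hq : ∀ k, 1 ≤ k → qn q k ≠ 0) (H : HR q T) (j m : ℕ) (hm : m + 1 < j) (y : X) :
    asym q T j (T m y) = - asym q T j y := by
  rw [← asym_eq_Top hq H, ← asym_eq_Top hq H]
  have := kill_asym (Top_HR (Q := X) H) j LinearMap.id m hm
  exact congrArg (fun f => f y) this

theorem asym_idem (hq : ∀ k, 1 ≤ k → qn q k ≠ 0) (H : HR q T) (j : ℕ) (y : X) : asym q T j (asym q T j y) = asym q T j y :=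
  asym_fix hq j _ (kill_asym H j y)

/-- absorption: a longer antisymmetrizer absorbs anything that fixes signs -/
theorem asym_unique (hq : ∀ k, 1 ≤ k → qn q k ≠ 0) {T' : ℕ → Module.End K X}
    (H : HR q T) (H' : HR q T') (j : ℕ)
    (h : ∀ m, m + 1 < j → ∃ m', m' + 1 < j ∧ T m = T' m')
    (h' : ∀ m, m + 1 < j → ∃ m', m' + 1 < j ∧ T' m = T m') (y : X) :
    asym q T j y = asym q T' j y := by
  have h1 : asym q T j (asym q T' j y) = asym q T' j y := asym_fix hq j _ (fun m hm => by
    obtain ⟨m', hm', e⟩ := h m hm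
    rw [e]; exact kill_asym H' j y m' hm')
  have h2 := asym_fix_right hq (T := T') (asym q T j) j (fun m hm y => by
    obtain ⟨m', hm', e⟩ := h' m hm
    rw [e]; exact asym_kill_right hq H j m' hm' y) y
  rw [← h2, h1]

theorem asym_sandwich (hq : ∀ k, 1 ≤ k → qn q k ≠ 0) (H : HR q T) (j : ℕ) (y : X) :
    qn q (j + 2) • asym q T (j + 2) y =
      q ^ (j + 1) • asym q T (j + 1) y
        - qn q (j + 1) • asym q T (j + 1) (T j (asym q T (j + 1) y)) := by
  have h1 : asym q T (j + 1) (asym q T (j + 2) y) = asym q T (j + 2) y :=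
    asym_fix hq (j + 1) _ (fun m hm => kill_asym H (j + 2) y m (by omega))
  rw [← h1, asym_succ_apply (j + 1), map_smul, smul_inv_smul₀ (hq _ (by omega)),
    cc_succ_apply, map_sub, map_smul, asym_idem hq H,
    cc_fix_right (asym q T (j + 1)) j (fun m hm y => asym_kill_right hq H _ m (by omega) y)]

/-- The opposite sign family. -/
def sharp (q : K) (T : ℕ → Module.End K X) : ℕ → Module.End K X := fun m => (q - 1) • 1 - T m

theorem sharp_apply (m : ℕ) (x : X) : sharp q T m x = (q - 1) • x - T m x := by simp [sharp]

theorem sharp_HR (H : HR q T) : HR q (sharp q T) where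
  quad i x := by
    simp only [sharp_apply, map_sub, map_smul, H.quad]
    module
  braid i x := by
    simp only [sharp_apply, map_sub, map_smul, H.quad, H.braid, map_add]
    module
  comm i j x h := by
    simp only [sharp_apply, map_sub, map_smul, H.comm i j x h]
    module

end Abstract
end HeckeProof


namespace HeckeProof

set_option linter.unusedSectionVars false
section Model
variable {K : Type*} [Field K] {ι : Type*} [Fintype ι] [DecidableEq ι]

/-- replace the entries at `i`, `i+1`. -/
def u2 (i : ℤ) (w : ℤ → ι) (c d : ι) : ℤ → ι :=
  Function.update (Function.update w i c) (i + 1) d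

theorem u2_apply (i : ℤ) (w : ℤ → ι) (c d : ι) (k : ℤ) :
    u2 i w c d k = if k = i + 1 then d else if k = i then c else w k := by
  simp only [u2, Function.update_apply]

@[simp] theorem u2_left (i : ℤ) (w : ℤ → ι) (c d : ι) : u2 i w c d i = c := by
  simp [u2_apply]
@[simp] theorem u2_right (i : ℤ) (w : ℤ → ι) (c d : ι) : u2 i w c d (i + 1) = d := by
  simp [u2_apply]

/-- operator on position `i,i+1` given by matrix `M`. -/
def Tz (M : ι → ι → ι → ι → K) (i : ℤ) : Module.End K ((ℤ → ι) → K) where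
  toFun f := fun w => ∑ c, ∑ d, M (w i) (w (i + 1)) c d * f (u2 i w c d)
  map_add' f g := by
    funext w; simp only [Pi.add_apply, mul_add, Finset.sum_add_distrib]
  map_smul' r f := by
    funext w
    simp only [Pi.smul_apply, smul_eq_mul, RingHom.id_apply, Finset.mul_sum]
    refine Finset.sum_congr rfl fun c _ => Finset.sum_congr rfl fun d _ => by ring

theorem Tz_apply (M : ι → ι → ι → ι → K) (i : ℤ) (f : (ℤ → ι) → K) (w : ℤ → ι) :
    Tz M i f w = ∑ c, ∑ d, M (w i) (w (i + 1)) c d * f (u2 i w c d) := rfl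

/-- Coordinates version of a Hecke operator. -/
structure MH (q : K) (M : ι → ι → ι → ι → K) : Prop where
  quad : ∀ x y c d, ∑ a, ∑ b, M x y a b * M a b c d =
    (q - 1) * M x y c d + q * (if x = c ∧ y = d then 1 else 0)
  yb : ∀ x y z e g d, ∑ a, ∑ b, ∑ c, M x y a b * M b z c d * M a c e g =
    ∑ a, ∑ b, ∑ c, M y z a b * M x a e c * M c b g d

variable {q : K} {M : ι → ι → ι → ι → K}

theorem u2_self (i : ℤ) (w : ℤ → ι) : u2 i w (w i) (w (i + 1)) = w := by
  funext k; rw [u2_apply]; split_ifs with h1 h2 <;> simp_all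

theorem u2_u2 (i : ℤ) (w : ℤ → ι) (a b c d : ι) : u2 i (u2 i w a b) c d = u2 i w c d := by
  funext k; simp only [u2_apply]; split_ifs <;> rfl

theorem u2_comm (i j : ℤ) (h : i + 2 ≤ j) (w : ℤ → ι) (a b c d : ι) :
    u2 i (u2 j w a b) c d = u2 j (u2 i w c d) a b := by
  funext k; simp only [u2_apply]; split_ifs <;> first | rfl | omega

theorem Tz_quad (H : MH q M) (i : ℤ) (f : (ℤ → ι) → K) :
    Tz M i (Tz M i f) = (q - 1) • Tz M i f + q • f := by
  funext w
  simp only [Tz_apply, Pi.add_apply, Pi.smul_apply, smul_eq_mul, u2_left, u2_right, u2_u2]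
  have h1 : ∑ a, ∑ b, M (w i) (w (i + 1)) a b * ∑ c, ∑ d, M a b c d * f (u2 i w c d) =
      ∑ c, ∑ d, (∑ a, ∑ b, M (w i) (w (i + 1)) a b * M a b c d) * f (u2 i w c d) := by
    simp only [Finset.mul_sum, Finset.sum_mul]
    simp only [← Fintype.sum_prod_type']
    let e : (ι × ι × ι × ι) ≃ (ι × ι × ι × ι) :=
      ⟨fun p => (p.2.2.1, p.2.2.2, p.1, p.2.1), fun p => (p.2.2.1, p.2.2.2, p.1, p.2.1),
        fun p => rfl, fun p => rfl⟩
    refine Fintype.sum_equiv e _ _ (fun p => ?_)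
    simp only [e, Equiv.coe_fn_mk]; ring
  rw [h1]
  simp only [H.quad, add_mul, Finset.sum_add_distrib, Finset.mul_sum]
  congr 1
  · refine Finset.sum_congr rfl fun c _ => Finset.sum_congr rfl fun d _ => by ring
  · rw [Finset.sum_eq_single (w i), Finset.sum_eq_single (w (i + 1))]
    · simp [u2_self]
    · intro d _ hd; simp [Ne.symm hd]
    · simp
    · intro c _ hc; simp [Ne.symm hc]
    · simp

theorem Tz_braid (H : MH q M) (i : ℤ) (f : (ℤ → ι) → K) :
    Tz M i (Tz M (i + 1) (Tz M i f)) = Tz M (i + 1) (Tz M i (Tz M (i + 1) f)) := by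
  funext w
  let G : ι → ι → ι → K := fun e g d => f (u2 i (u2 (i + 1) w g d) e g)
  have hL : Tz M i (Tz M (i + 1) (Tz M i f)) w = ∑ e, ∑ g, ∑ d,
      (∑ a, ∑ b, ∑ c, M (w i) (w (i + 1)) a b * M b (w (i + 2)) c d * M a c e g) * G e g d := by
    have : Tz M i (Tz M (i + 1) (Tz M i f)) w = ∑ a, ∑ b, M (w i) (w (i + 1)) a b *
        ∑ c, ∑ d, M b (w (i + 2)) c d * ∑ e, ∑ g, M a c e g * G e g d := by
      rw [Tz_apply]
      refine Finset.sum_congr rfl fun a _ => Finset.sum_congr rfl fun b _ => ?_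
      congr 1
      rw [Tz_apply]
      refine Finset.sum_congr rfl fun c _ => Finset.sum_congr rfl fun d _ => ?_
      congr 1
      · congr 1
        · rw [u2_right]
        · rw [u2_apply]; simp [show i + 1 + 1 = i + 2 by ring]
      · rw [Tz_apply]
        refine Finset.sum_congr rfl fun e _ => Finset.sum_congr rfl fun g _ => ?_
        congr 1
        · congr 1
          · simp [u2_apply]; try omega
          · simp [u2_apply]; try omega
        · simp only [G]; congr 1; funext k
          simp only [u2_apply]; split_ifs <;> first | rfl | omega
    rw [this]
    simp only [Finset.mul_sum, Finset.sum_mul]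
    simp only [← Fintype.sum_prod_type']
    let e : (ι × ι × ι × ι × ι × ι) ≃ (ι × ι × ι × ι × ι × ι) :=
      ⟨fun ⟨a, b, c, d, e, g⟩ => (e, g, d, a, b, c),
       fun ⟨e, g, d, a, b, c⟩ => (a, b, c, d, e, g),
        fun p => rfl, fun p => rfl⟩
    refine Fintype.sum_equiv e _ _ (fun p => ?_)
    simp only [e, Equiv.coe_fn_mk]; ring
  have hR : Tz M (i + 1) (Tz M i (Tz M (i + 1) f)) w = ∑ e, ∑ g, ∑ d,
      (∑ a, ∑ b, ∑ c, M (w (i + 1)) (w (i + 2)) a b * M (w i) a e c * M c b g d) * G e g d := by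
    have : Tz M (i + 1) (Tz M i (Tz M (i + 1) f)) w =
        ∑ a, ∑ b, M (w (i + 1)) (w (i + 2)) a b *
        ∑ e, ∑ c, M (w i) a e c * ∑ g, ∑ d, M c b g d * G e g d := by
      rw [Tz_apply]
      refine Finset.sum_congr rfl fun a _ => Finset.sum_congr rfl fun b _ => ?_
      congr 1
      · rw [show i + 1 + 1 = i + 2 by ring]
      rw [Tz_apply]
      refine Finset.sum_congr rfl fun c _ => Finset.sum_congr rfl fun d _ => ?_
      congr 1
      · congr 1
        · rw [u2_apply]; simp; try omega
        · rw [u2_left]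
      · rw [Tz_apply]
        refine Finset.sum_congr rfl fun e _ => Finset.sum_congr rfl fun g _ => ?_
        congr 1
        · congr 1
          · simp [u2_apply]; try omega
          · simp [u2_apply]; try omega
        · simp only [G]; congr 1; funext k
          simp only [u2_apply]; split_ifs <;> first | rfl | omega
    rw [this]
    simp only [Finset.mul_sum, Finset.sum_mul]
    simp only [← Fintype.sum_prod_type']
    let e : (ι × ι × ι × ι × ι × ι) ≃ (ι × ι × ι × ι × ι × ι) :=
      ⟨fun ⟨a, b, e, c, g, d⟩ => (e, g, d, a, b, c),
       fun ⟨e, g, d, a, b, c⟩ => (a, b, e, c, g, d),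
        fun p => rfl, fun p => rfl⟩
    refine Fintype.sum_equiv e _ _ (fun p => ?_)
    simp only [e, Equiv.coe_fn_mk]; ring
  rw [hL, hR]
  simp only [H.yb]

theorem Tz_comm (i j : ℤ) (h : i + 2 ≤ j) (f : (ℤ → ι) → K) :
    Tz M i (Tz M j f) = Tz M j (Tz M i f) := by
  funext w
  have e1 : ∀ a b, u2 i w a b j = w j := fun a b => by
    rw [u2_apply, if_neg (by omega), if_neg (by omega)]
  have e2 : ∀ a b, u2 i w a b (j + 1) = w (j + 1) := fun a b => by
    rw [u2_apply, if_neg (by omega), if_neg (by omega)]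
  have e3 : ∀ a b, u2 j w a b i = w i := fun a b => by
    rw [u2_apply, if_neg (by omega), if_neg (by omega)]
  have e4 : ∀ a b, u2 j w a b (i + 1) = w (i + 1) := fun a b => by
    rw [u2_apply, if_neg (by omega), if_neg (by omega)]
  simp only [Tz_apply, e1, e2, e3, e4, u2_comm i j h, Finset.mul_sum]
  simp only [← Fintype.sum_prod_type']
  let e : (ι × ι × ι × ι) ≃ (ι × ι × ι × ι) :=
      ⟨fun p => (p.2.2.1, p.2.2.2, p.1, p.2.1), fun p => (p.2.2.1, p.2.2.2, p.1, p.2.1),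
        fun p => rfl, fun p => rfl⟩
  refine Fintype.sum_equiv e _ _ (fun p => ?_)
  simp only [e, Equiv.coe_fn_mk]; ring

/-- forward and backward families -/
def fwd (M : ι → ι → ι → ι → K) (l : ℤ) (m : ℕ) : Module.End K ((ℤ → ι) → K) := Tz M (l + m)
def rev (M : ι → ι → ι → ι → K) (l : ℤ) (m : ℕ) : Module.End K ((ℤ → ι) → K) := Tz M (l - m)

theorem fwd_HR (H : MH q M) (l : ℤ) : HR q (fwd M l) where
  quad i x := Tz_quad H _ x
  braid i x := by
    have := Tz_braid H (l + i) x
    simpa only [fwd, Nat.cast_add, Nat.cast_one, add_assoc] using this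
  comm i j x h := Tz_comm _ _ (by omega) x

theorem rev_HR (H : MH q M) (l : ℤ) : HR q (rev M l) where
  quad i x := Tz_quad H _ x
  braid i x := by
    have := Tz_braid H (l - (i + 1)) x
    rw [show l - ((i:ℤ) + 1) + 1 = l - i by ring] at this
    simpa only [rev, Nat.cast_add, Nat.cast_one] using this.symm
  comm i j x h := (Tz_comm _ _ (by omega) x).symm

/-- functions depending only on the coordinates `0..N-1` -/
def Xs (K : Type*) [Field K] (ι : Type*) (N : ℕ) : Submodule K ((ℤ → ι) → K) where
  carrier := {f | ∀ w w' : ℤ → ι, (∀ i : ℤ, 0 ≤ i → i < N → w i = w' i) → f w = f w'}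
  add_mem' hf hg w w' h := by simp only [Pi.add_apply]; rw [hf w w' h, hg w w' h]
  zero_mem' _ _ _ := rfl
  smul_mem' r f hf w w' h := by simp only [Pi.smul_apply]; rw [hf w w' h]

theorem Tz_mem (N : ℕ) (i : ℤ) (h0 : 0 ≤ i) (h1 : i + 1 < N) (f : (ℤ → ι) → K) (hf : f ∈ Xs K ι N) :
    Tz M i f ∈ Xs K ι N := by
  intro w w' h
  simp only [Tz_apply]
  rw [h i h0 (by omega), h (i + 1) (by omega) h1]
  refine Finset.sum_congr rfl fun c _ => Finset.sum_congr rfl fun d _ => ?_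
  congr 1
  refine hf _ _ fun k hk hk' => ?_
  simp only [u2_apply, h k hk hk']

theorem Xs_mono {N N' : ℕ} (h : N ≤ N') : Xs K ι N ≤ Xs K ι N' :=
  fun _ hf w w' h' => hf w w' fun i h0 h1 => h' i h0 (by omega)

/-- concatenation product -/
def ten (j : ℕ) (u y : (ℤ → ι) → K) : (ℤ → ι) → K := fun w => u w * y (fun i => w (i + j))

theorem ten_mem {j i : ℕ} {u y : (ℤ → ι) → K} (hu : u ∈ Xs K ι j) (hy : y ∈ Xs K ι i) :
    ten j u y ∈ Xs K ι (j + i) := by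
  intro w w' h
  simp only [ten]
  rw [hu w w' fun k h0 h1 => h k h0 (by push_cast; omega),
    hy (fun i => w (i + j)) (fun i => w' (i + j)) fun k h0 h1 => h _ (by omega) (by push_cast; omega)]

theorem Tz_ten_left {j i : ℕ} {u y : (ℤ → ι) → K} (hy : y ∈ Xs K ι i)
    (m : ℤ) (hm : m + 1 < j) : Tz M m (ten j u y) = ten j (Tz M m u) y := by
  funext w
  simp only [ten, Tz_apply, Finset.sum_mul]
  refine Finset.sum_congr rfl fun c _ => Finset.sum_congr rfl fun d _ => ?_
  rw [← mul_assoc]; congr 1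
  refine hy _ _ fun k hk hk' => ?_
  rw [u2_apply, if_neg (by omega), if_neg (by omega)]

theorem Tz_ten_right {j : ℕ} {u y : (ℤ → ι) → K} (hu : u ∈ Xs K ι j)
    (m : ℤ) (hm : 0 ≤ m) : Tz M (j + m) (ten j u y) = ten j u (Tz M m y) := by
  funext w
  simp only [ten, Tz_apply, Finset.mul_sum]
  refine Finset.sum_congr rfl fun c _ => Finset.sum_congr rfl fun d _ => ?_
  have e1 : u (u2 (j + m) w c d) = u w := hu _ _ fun k hk hk' => by
    rw [u2_apply, if_neg (by omega), if_neg (by omega)]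
  have e2 : (fun i => u2 (↑j + m) w c d (i + ↑j)) = u2 m (fun i => w (i + ↑j)) c d := by
    funext k; simp only [u2_apply]
    congr 1
    · simp only [eq_iff_iff]; omega
    · congr 1
      simp only [eq_iff_iff]; omega
  rw [e1, e2, show m + 1 + (j:ℤ) = j + m + 1 by ring, add_comm m (j:ℤ)]
  ring

/-- the other sign -/
def Msh (q : K) (M : ι → ι → ι → ι → K) : ι → ι → ι → ι → K := fun x y c d =>
  (q - 1) * (if x = c ∧ y = d then 1 else 0) - M x y c d

theorem Tz_Msh (i : ℤ) (f : (ℤ → ι) → K) : Tz (Msh q M) i f = (q - 1) • f - Tz M i f := by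
  funext w
  simp only [Tz_apply, Msh, sub_mul _ (M _ _ _ _), Finset.sum_sub_distrib, Pi.sub_apply, Pi.smul_apply]
  congr 1
  rw [Finset.sum_eq_single (w i), Finset.sum_eq_single (w (i + 1))]
  · simp [u2_self]
  · intro d _ hd; simp [Ne.symm hd]
  · simp
  · intro c _ hc; simp [Ne.symm hc]
  · simp

theorem fwd_Msh (l : ℤ) : fwd (Msh q M) l = sharp q (fwd M l) := by
  funext m; ext1 f; rw [sharp_apply]; exact Tz_Msh _ _

theorem rev_Msh (l : ℤ) : rev (Msh q M) l = sharp q (rev M l) := by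
  funext m; ext1 f; rw [sharp_apply]; exact Tz_Msh _ _

end Model
end HeckeProof

set_option linter.unusedSectionVars false

namespace HeckeProof

section Trace
variable {K : Type*} [Field K] {ι : Type*} [Fintype ι] [DecidableEq ι] [Inhabited ι]

/-- extend a finite word by a default letter -/
def wext (N : ℕ) (v : Fin N → ι) : ℤ → ι :=
  fun i => if h : 0 ≤ i ∧ i < N then v ⟨i.toNat, by omega⟩ else default

theorem wext_coe (N : ℕ) (v : Fin N → ι) (i : Fin N) : wext N v (i : ℕ) = v i := by
  unfold wext
  rw [dif_pos ⟨by omega, by exact_mod_cast i.2⟩]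
  congr 1

/-- inflation -/
def inf (K : Type*) [Field K] (ι : Type*) (N : ℕ) : ((Fin N → ι) → K) →ₗ[K] ((ℤ → ι) → K) where
  toFun g := fun w => g (fun i => w (i : ℕ))
  map_add' _ _ := rfl
  map_smul' _ _ := rfl

/-- restriction to finite words -/
def res (K : Type*) [Field K] (ι : Type*) [Inhabited ι] (N : ℕ) :
    ((ℤ → ι) → K) →ₗ[K] ((Fin N → ι) → K) where
  toFun f := fun v => f (wext N v)
  map_add' _ _ := rfl
  map_smul' _ _ := rfl

theorem inf_apply (N : ℕ) (g : (Fin N → ι) → K) (w : ℤ → ι) :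
    inf K ι N g w = g (fun i => w (i : ℕ)) := rfl
theorem res_apply (N : ℕ) (f : (ℤ → ι) → K) (v : Fin N → ι) :
    res K ι N f v = f (wext N v) := rfl

theorem res_inf (N : ℕ) (g : (Fin N → ι) → K) : res K ι N (inf K ι N g) = g := by
  funext v; rw [res_apply, inf_apply]; congr 1; funext i; exact wext_coe N v i

theorem inf_mem (N : ℕ) (g : (Fin N → ι) → K) : inf K ι N g ∈ Xs K ι N := by
  intro w w' h
  rw [inf_apply, inf_apply]; congr 1; funext i
  exact h _ (by omega) (by exact_mod_cast i.2)

theorem inf_res (N : ℕ) (f : (ℤ → ι) → K) (hf : f ∈ Xs K ι N) : inf K ι N (res K ι N f) = f := by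
  funext w
  rw [inf_apply, res_apply]
  refine hf _ _ fun i h0 h1 => ?_
  obtain ⟨m, rfl⟩ := Int.eq_ofNat_of_zero_le h0
  exact wext_coe N (fun i => w (i : ℕ)) ⟨m, by exact_mod_cast h1⟩

/-- compression to finite words -/
def cmp (N : ℕ) (A : Module.End K ((ℤ → ι) → K)) : Module.End K ((Fin N → ι) → K) :=
  res K ι N ∘ₗ A ∘ₗ inf K ι N

/-- preserves `Xs N` -/
def Pres (N : ℕ) (A : Module.End K ((ℤ → ι) → K)) : Prop := ∀ f ∈ Xs K ι N, A f ∈ Xs K ι N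

theorem cmp_mul (N : ℕ) (A B : Module.End K ((ℤ → ι) → K)) (hB : Pres N B) :
    cmp N (A * B) = cmp N A * cmp N B := by
  refine LinearMap.ext fun g => ?_
  change res K ι N (A (B (inf K ι N g))) = res K ι N (A (inf K ι N (res K ι N (B (inf K ι N g)))))
  rw [inf_res _ _ (hB _ (inf_mem _ _))]

/-- trace over finite words -/
noncomputable def trN (N : ℕ) (A : Module.End K ((ℤ → ι) → K)) : K :=
  LinearMap.trace K _ (cmp N A)

theorem trN_comm (N : ℕ) (A B : Module.End K ((ℤ → ι) → K)) (hA : Pres N A) (hB : Pres N B) :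
    trN N (A * B) = trN N (B * A) := by
  rw [trN, trN, cmp_mul _ _ _ hB, cmp_mul _ _ _ hA, LinearMap.trace_mul_comm]

theorem trN_add (N : ℕ) (A B : Module.End K ((ℤ → ι) → K)) :
    trN N (A + B) = trN N A + trN N B := by
  rw [trN, trN, trN, ← map_add]; congr 1
theorem trN_sub (N : ℕ) (A B : Module.End K ((ℤ → ι) → K)) :
    trN N (A - B) = trN N A - trN N B := by
  rw [trN, trN, trN, ← map_sub]; congr 1
theorem trN_smul (N : ℕ) (r : K) (A : Module.End K ((ℤ → ι) → K)) :
    trN N (r • A) = r * trN N A := by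
  rw [trN, trN, ← smul_eq_mul, ← map_smul]; congr 1

theorem trN_eq_sum (N : ℕ) (A : Module.End K ((ℤ → ι) → K)) :
    trN N A = ∑ v, A (inf K ι N (Pi.single v 1)) (wext N v) := by
  rw [trN, LinearMap.trace_eq_matrix_trace K (Pi.basisFun K (Fin N → ι)), Matrix.trace]
  refine Finset.sum_congr rfl fun v _ => ?_
  rw [Matrix.diag_apply, LinearMap.toMatrix_apply]
  simp [cmp, res_apply]

theorem trN_congr (N : ℕ) (A B : Module.End K ((ℤ → ι) → K))
    (h : ∀ f ∈ Xs K ι N, A f = B f) : trN N A = trN N B := by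
  rw [trN, trN]; congr 1; refine LinearMap.ext fun g => ?_; simp only [cmp, LinearMap.comp_apply]; rw [h _ (inf_mem _ _)]

theorem trN_ten (j i : ℕ) (A B C : Module.End K ((ℤ → ι) → K))
    (hB : Pres j B) (hC : Pres i C)
    (h : ∀ u ∈ Xs K ι j, ∀ y ∈ Xs K ι i, A (ten j u y) = ten j (B u) (C y)) :
    trN (j + i) A = trN j B * trN i C := by
  rw [trN_eq_sum, trN_eq_sum, trN_eq_sum, Finset.sum_mul_sum, ← Fintype.sum_prod_type']
  symm
  refine Fintype.sum_equiv (Fin.appendEquiv j i) _ _ ?_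
  rintro ⟨v, v'⟩
  have e1 : inf K ι (j + i) (Pi.single (Fin.append v v') 1) =
      ten j (inf K ι j (Pi.single v 1)) (inf K ι i (Pi.single v' 1)) := by
    funext w
    simp only [ten, inf_apply, Pi.single_apply, mul_ite, mul_one, mul_zero]
    rw [← ite_and]
    congr 1
    rw [eq_iff_iff]
    constructor
    · intro h
      refine ⟨funext fun a => ?_, funext fun a => ?_⟩
      · have := congrFun h (Fin.natAdd j a)
        simp only [Fin.append_right, Fin.val_natAdd] at this
        rw [← this]; congr 1; push_cast; ring
      · have := congrFun h (Fin.castAdd i a)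
        simpa using this
    · rintro ⟨h1, h2⟩
      funext a
      refine Fin.addCases (fun a => ?_) (fun a => ?_) a
      · rw [Fin.append_left, ← h2]; rfl
      · rw [Fin.append_right, ← h1, Fin.val_natAdd]; congr 1; push_cast; ring
  change _ = A (inf K ι (j + i) (Pi.single (Fin.append v v') 1)) (wext (j + i) (Fin.append v v'))
  rw [e1, h _ (inf_mem _ _) _ (inf_mem _ _), ten]
  congr 1
  · refine hB _ (inf_mem _ _) _ _ fun k h0 h1 => ?_
    obtain ⟨m, rfl⟩ := Int.eq_ofNat_of_zero_le h0
    have hm : m < j := by exact_mod_cast h1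
    rw [show (m : ℤ) = ((⟨m, hm⟩ : Fin j) : ℕ) from rfl, wext_coe]
    have := wext_coe (j + i) (Fin.append v v') (Fin.castAdd i ⟨m, hm⟩)
    rw [Fin.append_left] at this
    exact this.symm
  · refine hC _ (inf_mem _ _) _ _ fun k h0 h1 => ?_
    obtain ⟨m, rfl⟩ := Int.eq_ofNat_of_zero_le h0
    have hm : m < i := by exact_mod_cast h1
    have e2 : wext i v' (Int.ofNat m) = v' ⟨m, hm⟩ := wext_coe i v' ⟨m, hm⟩
    have := wext_coe (j + i) (Fin.append v v') (Fin.natAdd j ⟨m, hm⟩)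
    rw [Fin.append_right] at this
    refine e2.trans (this.symm.trans ?_); congr 1; simp; ring

end Trace

section Koszul
variable {K : Type*} [Field K] {ι : Type*} [Fintype ι] [DecidableEq ι] [Inhabited ι]
variable {q : K} {M : ι → ι → ι → ι → K}

theorem asym_fwd_pres (N l j : ℕ) (h : l + j ≤ N) : Pres N (asym q (fwd M l) j) := by
  intro f hf
  exact asym_mem _ _ (fun m hm y hy => Tz_mem N _ (by omega) (by omega) y hy) f hf

/-- dimension of the degree `k` part -/
noncomputable def lam (q : K) (M : ι → ι → ι → ι → K) (k : ℕ) : ℕ :=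
  Module.finrank K (LinearMap.range (cmp k (asym q (fwd M 0) k)))

theorem trN_asym (hq : ∀ k, 1 ≤ k → qn q k ≠ 0) (H : HR q (fwd M 0)) (k : ℕ) :
    trN k (asym q (fwd M 0) k) = lam q M k := by
  have hp : Pres k (asym q (fwd M 0) k) := by
    have := asym_fwd_pres (q := q) (M := M) k 0 k (by omega); simpa using this
  have hi : IsIdempotentElem (cmp k (asym q (fwd M 0) k)) := by
    rw [IsIdempotentElem, ← cmp_mul _ _ _ hp]; congr 1; ext1 f; exact asym_idem hq H k f
  exact (LinearMap.IsIdempotentElem.isProj_range _ hi).trace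

theorem asym_ten (j i : ℕ) (u y : (ℤ → ι) → K) (hu : u ∈ Xs K ι j) (hy : y ∈ Xs K ι i) :
    asym q (fwd M 0) j (ten j u y) = ten j (asym q (fwd M 0) j u) y := by
  let Ψ : ((ℤ → ι) → K) →ₗ[K] ((ℤ → ι) → K) :=
    { toFun := fun u => ten j u y
      map_add' := fun a b => by funext w; simp [ten, add_mul]
      map_smul' := fun a b => by funext w; simp [ten, mul_assoc] }
  exact (asym_nat (q := q) (T := fwd M 0) (T' := fwd M 0) (Xs K ι j) Ψ j (fun m hm z hz =>
    ⟨Tz_mem j _ (by omega) (by omega) z hz, Tz_ten_left hy _ (by omega)⟩) u hu).2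

theorem asym_ten_right (j i : ℕ) (u y : (ℤ → ι) → K) (hu : u ∈ Xs K ι j) :
    asym q (fwd M j) i (ten j u y) = ten j u (asym q (fwd M 0) i y) := by
  let Ψ : ((ℤ → ι) → K) →ₗ[K] ((ℤ → ι) → K) :=
    { toFun := fun y => ten j u y
      map_add' := fun a b => by funext w; simp [ten, mul_add]
      map_smul' := fun a b => by funext w; simp [ten, mul_left_comm] }
  exact (asym_nat (q := q) (T := fwd M j) (T' := fwd M 0) ⊤ Ψ i (fun m hm z hz =>
    ⟨trivial, by
      have := Tz_ten_right (M := M) (y := z) hu m (by omega)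
      simpa [fwd, Ψ] using this⟩) y trivial).2

theorem fwd_comm (A B : ι → ι → ι → ι → K) (h : ∀ i j f, i + 2 ≤ j →
      Tz A i (Tz B j f) = Tz B j (Tz A i f)) (j i : ℕ) :
    asym q (fwd A 0) j * asym q (fwd B j) i = asym q (fwd B j) i * asym q (fwd A 0) j := by
  ext1 f
  simp only [Module.End.mul_apply]
  refine asym_comm _ _ (fun m hm y => ?_) f
  symm
  refine asym_comm _ _ (fun m' hm' y => ?_) y
  exact (h _ _ _ (by omega)).symm

theorem koszul_step (hq : ∀ k, 1 ≤ k → qn q k ≠ 0) (H : MH q M) (j i : ℕ) :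
    qn q (j + 2) * qn q (i + 1) * trN (j + i + 2)
        (asym q (fwd M 0) (j + 2) * asym q (fwd (Msh q M) (j + 1 : ℕ)) (i + 1)) +
      qn q (j + 1) * qn q (i + 2) * trN (j + i + 2)
        (asym q (fwd M 0) (j + 1) * asym q (fwd (Msh q M) (j : ℕ)) (i + 2)) =
      qn q (j + i + 2) * (lam q M (j + 1) * lam q (Msh q M) (i + 1)) := by
  set N := j + i + 2 with hN
  set A1 := asym q (fwd M 0) (j + 1) with hA1
  set A2 := asym q (fwd M 0) (j + 2) with hA2
  set S1 := asym q (fwd (Msh q M) (j + 1 : ℕ)) (i + 1) with hS1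
  set S2 := asym q (fwd (Msh q M) (j : ℕ)) (i + 2) with hS2
  set T := Tz M j with hT
  have Hs : ∀ l, HR q (fwd (Msh q M) l) := fun l => by rw [fwd_Msh]; exact sharp_HR (fwd_HR H l)
  have Hr : ∀ l, HR q (rev (Msh q M) l) := fun l => by rw [rev_Msh]; exact sharp_HR (rev_HR H l)
  have e1 : qn q (j + 2) • A2 = q ^ (j + 1) • A1 - qn q (j + 1) • (A1 * T * A1) := by
    ext1 f
    have := asym_sandwich hq (fwd_HR H 0) j f
    simpa [fwd] using this
  have r1 : ∀ f, asym q (rev (Msh q M) (j + i : ℕ)) (i + 1) f = S1 f := fun f => by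
    refine asym_unique hq (Hr _) (Hs _) _ (fun m hm => ⟨i - 1 - m, by omega, ?_⟩)
      (fun m hm => ⟨i - 1 - m, by omega, ?_⟩) f
    · simp only [rev, fwd]; congr 1; omega
    · simp only [rev, fwd]; congr 1; omega
  have r2 : ∀ f, asym q (rev (Msh q M) (j + i : ℕ)) (i + 2) f = S2 f := fun f => by
    refine asym_unique hq (Hr _) (Hs _) _ (fun m hm => ⟨i - m, by omega, ?_⟩)
      (fun m hm => ⟨i - m, by omega, ?_⟩) f
    · simp only [rev, fwd]; congr 1; omega
    · simp only [rev, fwd]; congr 1; omega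
  have i2 : ∀ f, S1 (S1 f) = S1 f := fun f => asym_idem hq (Hs _) _ f
  have e2 : qn q (i + 2) • S2 = S1 + qn q (i + 1) • (S1 * T * S1) := by
    ext1 f
    have := asym_sandwich hq (Hr (j + i : ℕ)) i f
    rw [r1, r1, r2] at this
    have e3 : rev (Msh q M) (j + i : ℕ) i = Tz (Msh q M) j := by
      rw [rev]; congr 1; omega
    rw [e3, Tz_Msh, map_sub, map_smul, i2] at this
    simp only [LinearMap.smul_apply, LinearMap.add_apply, Module.End.mul_apply]
    rw [this, smul_sub, smul_smul, mul_comm (qn q (i + 1)), qn_geom]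
    module
  have c : A1 * S1 = S1 * A1 := by
    refine fwd_comm _ _ (fun a b f hab => ?_) _ _
    rw [Tz_Msh, Tz_Msh, map_sub, map_smul, Tz_comm a b hab]
  have i1 : A1 * A1 = A1 := by ext1 f; exact asym_idem hq (fwd_HR H 0) (j + 1) f
  have i2' : S1 * S1 = S1 := by ext1 f; exact i2 f
  have pA : Pres N A1 := by
    have := asym_fwd_pres (q := q) (M := M) N 0 (j + 1) (by omega); simpa using this
  have pS : Pres N S1 := asym_fwd_pres (q := q) N (j + 1) (i + 1) (by omega)
  have pT : Pres N T := fun f hf => Tz_mem N _ (by omega) (by omega) f hf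
  have pm : ∀ {A B : Module.End K ((ℤ → ι) → K)}, Pres N A → Pres N B → Pres N (A * B) :=
    fun hA hB f hf => hA _ (hB _ hf)
  have t1 : trN N (A1 * T * A1 * S1) = trN N (T * S1 * A1) := by
    rw [mul_assoc _ A1, c, ← mul_assoc, trN_comm _ _ _ (pm (pm pA pT) pS) pA, ← mul_assoc,
      ← mul_assoc, i1, mul_assoc, mul_assoc, trN_comm _ _ _ pA (pm pT pS), mul_assoc]
  have t2 : trN N (A1 * (S1 * T * S1)) = trN N (T * S1 * A1) := by
    rw [← mul_assoc, ← mul_assoc, mul_assoc, trN_comm _ _ _ (pm pA pS) (pm pT pS), c, mul_assoc,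
      ← mul_assoc S1 S1, i2', ← mul_assoc]
  have t3 : trN N (A1 * S1) = lam q M (j + 1) * lam q (Msh q M) (i + 1) := by
    rw [← trN_asym hq (fwd_HR H 0), ← trN_asym hq (Hs 0)]
    have := trN_ten (j + 1) (i + 1) (A1 * S1) A1 (asym q (fwd (Msh q M) 0) (i + 1))
      (by simpa using asym_fwd_pres (q := q) (M := M) (j + 1) 0 (j + 1) (by omega))
      (by simpa using asym_fwd_pres (q := q) (M := Msh q M) (i + 1) 0 (i + 1) (by omega))
      (fun u hu y hy => by
        rw [Module.End.mul_apply, hS1, asym_ten_right _ _ _ _ hu]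
        refine asym_ten _ (i + 1) _ _ hu ?_
        exact (by simpa using asym_fwd_pres (q := q) (M := Msh q M) (i + 1) 0 (i + 1) (by omega) :
          Pres (i + 1) (asym q (fwd (Msh q M) 0) (i + 1))) _ hy)
    rw [← this]; congr 1; omega
  have f1 : qn q (j + 2) * trN N (A2 * S1) =
      q ^ (j + 1) * trN N (A1 * S1) - qn q (j + 1) * trN N (T * S1 * A1) := by
    rw [← trN_smul, ← smul_mul_assoc, e1, sub_mul, trN_sub, smul_mul_assoc, trN_smul,
      smul_mul_assoc, trN_smul, t1]
  have f2 : qn q (i + 2) * trN N (A1 * S2) =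
      trN N (A1 * S1) + qn q (i + 1) * trN N (T * S1 * A1) := by
    rw [← trN_smul, ← mul_smul_comm, e2, mul_add, trN_add, mul_smul_comm, trN_smul, t2]
  have f3 : qn q (j + i + 2) = q ^ (j + 1) * qn q (i + 1) + qn q (j + 1) := by
    rw [show j + i + 2 = (j + 1) + (i + 1) by ring, qn, Finset.sum_range_add, qn, qn,
      Finset.mul_sum, add_comm]
    simp only [pow_add]
  rw [← t3, f3]
  linear_combination qn q (i + 1) * f1 + qn q (j + 1) * f2

theorem koszul (hq : ∀ k, 1 ≤ k → qn q k ≠ 0) (H : MH q M) (k : ℕ) :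
    ∑ j ∈ Finset.range (k + 2), (-1 : K) ^ j * (lam q M j * lam q (Msh q M) (k + 1 - j)) = 0 := by
  have hl0 : ∀ M' : ι → ι → ι → ι → K, (lam q M' 0 : K) = 1 := fun M' => by
    have : lam q M' 0 = 1 := by
      have h : cmp 0 (asym q (fwd M' 0) 0) = LinearMap.id := by
        refine LinearMap.ext fun g => ?_
        exact res_inf 0 g
      rw [lam, h, LinearMap.range_id, finrank_top]; simp
    rw [this]; simp
  let h : ℕ → K := fun j => qn q (j + 1) * qn q (k + 1 - j) * trN (k + 1)
    (asym q (fwd M 0) (j + 1) * asym q (fwd (Msh q M) (j : ℕ)) (k + 1 - j))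
  have hs : ∀ j, j < k → h (j + 1) + h j =
      qn q (k + 1) * (lam q M (j + 1) * lam q (Msh q M) (k - j)) := fun j hj => by
    obtain ⟨i, rfl⟩ : ∃ i, k = j + i + 1 := ⟨k - j - 1, by omega⟩
    have := koszul_step hq H j i
    simp only [h]
    rw [show j + i + 1 + 1 - (j + 1) = i + 1 by omega, show j + i + 1 + 1 - j = i + 2 by omega,
      show j + i + 1 - j = i + 1 by omega]
    exact this
  have Hs : HR q (fwd (Msh q M) 0) := by rw [fwd_Msh]; exact sharp_HR (fwd_HR H 0)
  have h0 : h 0 = qn q (k + 1) * lam q (Msh q M) (k + 1) := by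
    rw [← trN_asym hq Hs]
    simp only [h, zero_add, qn_one, one_mul, Nat.sub_zero]
    congr 2
    ext1 f; exact asym_one_apply _
  have hk : h k = qn q (k + 1) * lam q M (k + 1) := by
    rw [← trN_asym hq (fwd_HR H 0)]
    simp only [h, show k + 1 - k = 1 by omega, qn_one, mul_one]
    congr 2
    ext1 f; rw [Module.End.mul_apply, asym_one_apply]
  have key : ∀ m, m ≤ k → qn q (k + 1) * ∑ j ∈ Finset.range (m + 1),
      (-1 : K) ^ j * (lam q M j * lam q (Msh q M) (k + 1 - j)) = (-1) ^ m * h m := by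
    intro m
    induction m with
    | zero => intro _; simp [hl0, h0]
    | succ m ih =>
      intro hm
      rw [Finset.sum_range_succ, mul_add, ih (by omega), show k + 1 - (m + 1) = k - m by omega]
      have := hs m (by omega)
      rw [pow_succ]
      linear_combination (-1) ^ m * this
  refine (mul_eq_zero.mp ?_).resolve_left (hq (k + 1) (by omega))
  rw [Finset.sum_range_succ, mul_add, key k le_rfl, hk, Nat.sub_self, hl0, pow_succ]
  ring

end Koszul
end HeckeProof

set_option linter.unusedSectionVars false

namespace HeckeProof

section Link
variable {K : Type*} [Field K] {ι : Type*} [Fintype ι] [DecidableEq ι] [Inhabited ι]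
variable {V : Type*} [AddCommGroup V] [Module K V]
variable {q : K} {M : ι → ι → ι → ι → K} {R : V ⊗[K] V →ₗ[K] V ⊗[K] V}
variable (b : Module.Basis ι K V)

/-- `M` is the matrix of `R` -/
def Rep (R : V ⊗[K] V →ₗ[K] V ⊗[K] V) (M : ι → ι → ι → ι → K) : Prop :=
  ∀ c d, R (b c ⊗ₜ b d) = ∑ x, ∑ y, M x y c d • (b x ⊗ₜ[K] b y)

theorem exists_rep (R : V ⊗[K] V →ₗ[K] V ⊗[K] V) :
    Rep b R (fun x y c d => (b.tensorProduct b).repr (R (b c ⊗ₜ b d)) (x, y)) := by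
  intro c d
  conv_lhs => rw [← (b.tensorProduct b).sum_repr (R (b c ⊗ₜ b d))]
  rw [Fintype.sum_prod_type]
  simp

theorem Rep.coord {b : Module.Basis ι K V} (h : Rep b R M) (x y c d : ι) :
    (b.tensorProduct b).repr (R (b c ⊗ₜ b d)) (x, y) = M x y c d := by
  rw [h]
  simp only [map_sum, map_smul, Finsupp.coe_finsetSum, Finset.sum_apply, Finsupp.smul_apply,
    Module.Basis.tensorProduct_repr_tmul_apply, Module.Basis.repr_self, Finsupp.single_apply]
  rw [Finset.sum_eq_single x, Finset.sum_eq_single y]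
  · simp
  · intro z _ hz; simp [hz]
  · simp
  · intro z _ hz; simp [hz]
  · simp

theorem Rep.sharp {b : Module.Basis ι K V} (h : Rep b R M) :
    Rep b ((q - 1) • LinearMap.id - R) (Msh q M) := by
  intro c d
  simp only [Msh, sub_smul _ (M _ _ _ _), Finset.sum_sub_distrib, LinearMap.sub_apply, h c d]
  congr 1
  rw [Finset.sum_eq_single c, Finset.sum_eq_single d]
  · simp
  · intro z _ hz; simp [hz]
  · simp
  · intro z _ hz; simp [hz]
  · simp

theorem toMH_of_isHecke {b : Module.Basis ι K V} (h : Rep b R M) (hR : IsHecke K V q R) : MH q M where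
  quad x y c d := by
    have h1 := congrArg (fun f => (b.tensorProduct b).repr (f (b c ⊗ₜ b d)) (x, y)) hR.2
    simp only [LinearMap.comp_apply, LinearMap.sub_apply, LinearMap.add_apply, map_sub,
      LinearMap.smul_apply, map_smul, LinearMap.id_apply, LinearMap.zero_apply, map_zero,
      Finsupp.coe_zero, Pi.zero_apply, map_add, Finsupp.sub_apply, Finsupp.add_apply,
      Finsupp.smul_apply] at h1
    rw [h.coord] at h1
    have h2 : (b.tensorProduct b).repr (R (R (b c ⊗ₜ b d))) (x, y) =
        ∑ a, ∑ b, M x y a b * M a b c d := by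
      rw [h c d]
      simp only [map_sum, map_smul, Finsupp.coe_finsetSum, Finset.sum_apply, Finsupp.smul_apply,
        h.coord, smul_eq_mul]
      refine Finset.sum_congr rfl fun _ _ => Finset.sum_congr rfl fun _ _ => by ring
    rw [h2] at h1
    have h3 : (b.tensorProduct b).repr (b c ⊗ₜ b d) (x, y) = if x = c ∧ y = d then 1 else 0 := by
      simp only [Module.Basis.tensorProduct_repr_tmul_apply, Module.Basis.repr_self,
        Finsupp.single_apply]
      simp only [eq_comm (a := c), eq_comm (a := d)]
      split_ifs <;> simp_all
    rw [h3] at h1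
    simp only [smul_eq_mul] at h1
    linear_combination h1
  yb x y z e g d := by
    have hy := hR.1
    simp only [YangBaxter] at hy
    set R₁ : (V ⊗[K] V) ⊗[K] V →ₗ[K] (V ⊗[K] V) ⊗[K] V := LinearMap.rTensor V R with hR1
    set R₂ : (V ⊗[K] V) ⊗[K] V →ₗ[K] (V ⊗[K] V) ⊗[K] V :=
      (TensorProduct.assoc K V V V).symm.toLinearMap ∘ₗ LinearMap.lTensor V R ∘ₗ
      (TensorProduct.assoc K V V V).toLinearMap with hR2
    have a1 : ∀ a c d, R₁ ((b a ⊗ₜ b c) ⊗ₜ b d) =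
        ∑ x, ∑ y, M x y a c • ((b x ⊗ₜ[K] b y) ⊗ₜ[K] b d) := fun a c d => by
      rw [hR1, LinearMap.rTensor_tmul, h a c]
      simp only [TensorProduct.sum_tmul, TensorProduct.smul_tmul']
    have a2 : ∀ a c d, R₂ ((b a ⊗ₜ b c) ⊗ₜ b d) =
        ∑ x, ∑ y, M x y c d • ((b a ⊗ₜ[K] b x) ⊗ₜ[K] b y) := fun a c d => by
      rw [hR2]
      simp only [LinearMap.comp_apply, LinearEquiv.coe_coe, TensorProduct.assoc_tmul,
        LinearMap.lTensor_tmul, h c d]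
      simp only [TensorProduct.tmul_sum, TensorProduct.tmul_smul, map_sum, map_smul,
        TensorProduct.assoc_symm_tmul]
    let β := (b.tensorProduct b).tensorProduct b
    have hβ : ∀ x' y' z', β.repr ((b x' ⊗ₜ[K] b y') ⊗ₜ[K] b z') ((x, y), z) =
        if x' = x ∧ y' = y ∧ z' = z then 1 else 0 := fun x' y' z' => by
      simp only [β, Module.Basis.tensorProduct_repr_tmul_apply, Module.Basis.repr_self,
        Finsupp.single_apply, smul_eq_mul]
      split_ifs <;> simp_all
    have h1 := congrArg (fun f => β.repr (f ((b e ⊗ₜ b g) ⊗ₜ b d)) ((x, y), z)) hy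
    simp only [LinearMap.comp_apply, a1, a2, map_sum, map_smul, Finsupp.coe_finsetSum,
      Finset.sum_apply, Finsupp.smul_apply, smul_eq_mul, hβ, ite_and, mul_ite,
      mul_one, mul_zero, Finset.sum_ite_irrel, Finset.sum_const_zero, Finset.sum_ite_eq',
      Finset.mem_univ, if_true, Finset.mul_sum] at h1
    have g1 : ∑ a, ∑ b, ∑ c, M x y a b * M b z c d * M a c e g =
        ∑ x_1, ∑ c, ∑ i, M x_1 c e g * (M i z c d * M x y x_1 i) := by
      refine Finset.sum_congr rfl fun a _ => ?_
      rw [Finset.sum_comm]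
      refine Finset.sum_congr rfl fun _ _ => Finset.sum_congr rfl fun _ _ => by ring
    have g2 : ∑ a, ∑ b, ∑ c, M y z a b * M x a e c * M c b g d =
        ∑ x_1, ∑ c, ∑ i, M x_1 c g d * (M x i e x_1 * M y z i c) := by
      rw [Finset.sum_comm]
      simp only [Finset.sum_comm (s := Finset.univ (α := ι)) (f := fun a c => M y z a _ * M x a e c * M c _ g d)]
      rw [Finset.sum_comm]
      refine Finset.sum_congr rfl fun _ _ => Finset.sum_congr rfl fun _ _ =>
        Finset.sum_congr rfl fun _ _ => by ring
    rw [g1, g2, h1]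

/-- prepend a letter -/
def wcons (c : ι) (w : ℤ → ι) : ℤ → ι := fun i => if i = 0 then c else w (i - 1)

/-- slice of a function at the first letter -/
def slice (K : Type*) [Field K] {ι : Type*} (c : ι) : Module.End K ((ℤ → ι) → K) where
  toFun f := fun w => f (wcons c w)
  map_add' _ _ := rfl
  map_smul' _ _ := rfl

theorem slice_apply (c : ι) (f : (ℤ → ι) → K) (w : ℤ → ι) : slice K c f w = f (wcons c w) := rfl

theorem slice_mem (k : ℕ) (c : ι) (f : (ℤ → ι) → K) (hf : f ∈ Xs K ι (k + 1)) :
    slice K c f ∈ Xs K ι k := by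
  intro w w' h
  refine hf _ _ fun i h0 h1 => ?_
  simp only [wcons]
  split_ifs with hi
  · rfl
  · exact h _ (by omega) (by push_cast at h1; omega)

theorem slice_Tz (c : ι) (m : ℤ) (hm : 0 ≤ m) (f : (ℤ → ι) → K) :
    slice K c (Tz M (m + 1) f) = Tz M m (slice K c f) := by
  funext w
  simp only [slice_apply, Tz_apply]
  have e1 : wcons c w (m + 1) = w m := by simp [wcons, show m + 1 ≠ 0 by omega]
  have e2 : wcons c w (m + 1 + 1) = w (m + 1) := by simp [wcons, show m + 1 + 1 ≠ 0 by omega]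
  rw [e1, e2]
  refine Finset.sum_congr rfl fun x _ => Finset.sum_congr rfl fun y _ => ?_
  congr 2
  funext i
  simp only [u2_apply, wcons]
  split_ifs <;> first | rfl | omega

theorem slice_Tz_zero (c d : ι) (f : (ℤ → ι) → K) :
    slice K d (slice K c (Tz M 0 f)) = ∑ x, ∑ y, M c d x y • slice K y (slice K x f) := by
  funext w
  simp only [slice_apply, Tz_apply, Finset.sum_apply, Pi.smul_apply, smul_eq_mul]
  refine Finset.sum_congr rfl fun x _ => Finset.sum_congr rfl fun y _ => ?_
  congr 1
  refine congrArg f ?_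
  funext i
  simp only [u2_apply, wcons]
  split_ifs <;> first | rfl | omega

/-- The map to the tensor algebra. -/
noncomputable def monZ : ℕ → ((ℤ → ι) → K) →ₗ[K] TensorAlgebra K V
  | 0 => (LinearMap.toSpanSingleton K (TensorAlgebra K V) 1) ∘ₗ
      (LinearMap.proj (fun _ => (default : ι)))
  | k + 1 => ∑ c, (LinearMap.mulLeft K (TensorAlgebra.ι K (b c))) ∘ₗ monZ k ∘ₗ slice K c

theorem monZ_zero (f : (ℤ → ι) → K) : monZ b 0 f = f (fun _ => default) • 1 := rfl
theorem monZ_succ (k : ℕ) (f : (ℤ → ι) → K) :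
    monZ b (k + 1) f = ∑ c, TensorAlgebra.ι K (b c) * monZ b k (slice K c f) := by
  simp [monZ]

/-- letter -/
noncomputable def lett (b : Module.Basis ι K V) (v : V) : (ℤ → ι) → K := fun w => b.repr v (w 0)

theorem lett_mem (v : V) : lett b v ∈ Xs K ι 1 := by
  intro w w' h; simp only [lett]; rw [h 0 le_rfl (by simp)]

theorem slice_ten (c : ι) (v : V) (k : ℕ) (g : (ℤ → ι) → K) (hg : g ∈ Xs K ι k) :
    slice K c (ten 1 (lett b v) g) = b.repr v c • g := by
  funext w
  simp only [slice_apply, ten, lett, Pi.smul_apply, smul_eq_mul]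
  have e1 : wcons c w 0 = c := by simp [wcons]
  rw [e1]
  congr 1
  refine hg _ _ fun i h0 h1 => ?_
  simp [wcons, show i + 1 ≠ 0 by omega]

theorem sum_ten_slice (k : ℕ) (f : (ℤ → ι) → K) (hf : f ∈ Xs K ι (k + 1)) :
    ∑ c, ten 1 (lett b (b c)) (slice K c f) = f := by
  funext w
  rw [Finset.sum_apply, Finset.sum_eq_single (w 0)]
  · simp only [ten, lett, Module.Basis.repr_self, Finsupp.single_eq_same, one_mul, slice_apply]
    refine hf _ _ fun i h0 h1 => ?_
    simp only [wcons]
    split_ifs with h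
    · rw [h]
    · simp
  · intro c _ hc
    simp [ten, lett, Finsupp.single_apply, hc]
  · simp

theorem monZ_range (k : ℕ) :
    Submodule.map (monZ b k) (Xs K ι k) = LinearMap.range (TensorAlgebra.ι K (M := V)) ^ k := by
  induction k with
  | zero =>
    rw [pow_zero]
    refine le_antisymm ?_ ?_
    · rintro _ ⟨f, -, rfl⟩
      rw [monZ_zero]
      exact Submodule.smul_mem _ _ (Submodule.one_le.mp le_rfl)
    · rw [Submodule.one_le]
      refine ⟨fun _ => 1, fun _ _ _ => rfl, ?_⟩
      simp [monZ_zero]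
  | succ k ih =>
    rw [pow_succ', ← ih]
    refine le_antisymm ?_ ?_
    · rintro _ ⟨f, hf, rfl⟩
      rw [monZ_succ]
      refine Submodule.sum_mem _ fun c _ => Submodule.mul_mem_mul ⟨_, rfl⟩
        ⟨_, slice_mem k c f hf, rfl⟩
    · rw [Submodule.mul_le]
      rintro _ ⟨v, rfl⟩ _ ⟨g, hg, rfl⟩
      refine ⟨ten 1 (lett b v) g, ?_, ?_⟩
      · rw [add_comm]; exact ten_mem (lett_mem b v) hg
      · rw [monZ_succ]
        conv_rhs => rw [← b.sum_repr v]
        rw [map_sum, Finset.sum_mul]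
        refine Finset.sum_congr rfl fun c _ => ?_
        rw [slice_ten b c v k g hg, map_smul, map_smul, smul_mul_assoc, mul_smul_comm]

theorem quadMul_tmul (v w : V) :
    quadMul K V (v ⊗ₜ w) = TensorAlgebra.ι K v * TensorAlgebra.ι K w := by
  simp [quadMul]

/-- quotient map -/
noncomputable def qpi (R : V ⊗[K] V →ₗ[K] V ⊗[K] V) :=
  RingQuot.mkAlgHom K (quadRel K V (LinearMap.range (R + LinearMap.id)))

theorem qpi_rel (t : V ⊗[K] V) : qpi R (quadMul K V (R t)) = - qpi R (quadMul K V t) := by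
  have h : quadRel K V (LinearMap.range (R + LinearMap.id)) (quadMul K V ((R + LinearMap.id : V ⊗[K] V →ₗ[K] V ⊗[K] V) t)) 0 :=
    ⟨rfl, _, ⟨t, rfl⟩, rfl⟩
  have h2 := RingQuot.mkAlgHom_rel K h
  rw [LinearMap.add_apply, LinearMap.id_apply, map_add, map_add, map_zero] at h2
  exact eq_neg_of_add_eq_zero_left h2

theorem qpi_monZ {b : Module.Basis ι K V} (h : Rep b R M) (k m : ℕ) : m + 1 < k → ∀ f ∈ Xs K ι k,
    qpi R (monZ b k (Tz M m f)) = - qpi R (monZ b k f) := by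
  induction k generalizing m with
  | zero => intro hm; omega
  | succ k ih =>
    intro hm f hf
    cases m with
    | succ m =>
      rw [monZ_succ, monZ_succ, map_sum, map_sum, ← Finset.sum_neg_distrib]
      refine Finset.sum_congr rfl fun c _ => ?_
      rw [map_mul, map_mul, Nat.cast_succ, slice_Tz c m (by omega),
        ih m (by omega) _ (slice_mem k c f hf)]
      exact mul_neg (α := RingQuot (quadRel K V (LinearMap.range (R + LinearMap.id)))) _ _
    | zero =>
      obtain ⟨k, rfl⟩ : ∃ l, k = l + 1 := ⟨k - 1, by omega⟩
      have e1 : ∀ f, monZ b (k + 1 + 1) f =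
          ∑ c, ∑ d, quadMul K V (b c ⊗ₜ b d) * monZ b k (slice K d (slice K c f)) := fun f => by
        simp only [monZ_succ, quadMul_tmul, Finset.mul_sum, mul_assoc]
      have e2 : monZ b (k + 1 + 1) (Tz M (0 : ℕ) f) =
          ∑ x, ∑ y, quadMul K V (R (b x ⊗ₜ b y)) * monZ b k (slice K y (slice K x f)) := by
        rw [e1]
        simp only [Nat.cast_zero, slice_Tz_zero _ _ f, h _ _, map_sum, map_smul,
          Finset.mul_sum, Finset.sum_mul, mul_smul_comm, smul_mul_assoc]
        simp only [← Fintype.sum_prod_type']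
        let e : (ι × ι × ι × ι) ≃ (ι × ι × ι × ι) :=
          ⟨fun p => (p.2.2.1, p.2.2.2, p.1, p.2.1), fun p => (p.2.2.1, p.2.2.2, p.1, p.2.1),
            fun p => rfl, fun p => rfl⟩
        refine Fintype.sum_equiv e _ _ (fun p => rfl)
      rw [e2, e1, map_sum, map_sum, ← Finset.sum_neg_distrib]
      refine Finset.sum_congr rfl fun c _ => ?_
      rw [map_sum, map_sum, ← Finset.sum_neg_distrib]
      refine Finset.sum_congr rfl fun d _ => ?_
      rw [map_mul, map_mul, qpi_rel]
      exact neg_mul (α := RingQuot (quadRel K V (LinearMap.range (R + LinearMap.id)))) _ _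

/-- multiplication operators used to detect the quotient. -/
noncomputable def ell (q : K) (M : ι → ι → ι → ι → K) :
    V →ₗ[K] Module.End K (ℕ → (ℤ → ι) → K) where
  toFun v :=
    { toFun := fun F k => match k with
        | 0 => 0
        | k + 1 => asym q (fwd M 0) (k + 1) (ten 1 (lett b v) (inf K ι k (res K ι k (F k))))
      map_add' := fun F G => by
        funext k
        cases k with
        | zero => simp
        | succ k =>
          simp only [Pi.add_apply, map_add]
          refine (congrArg (asym q (fwd M 0) (k + 1)) ?_).trans (map_add _ _ _)
          funext w; simp [ten, mul_add]
      map_smul' := fun r F => by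
        funext k
        cases k with
        | zero => simp
        | succ k =>
          simp only [Pi.smul_apply, map_smul, RingHom.id_apply]
          refine (congrArg (asym q (fwd M 0) (k + 1)) ?_).trans (map_smul _ _ _)
          funext w; simp [ten, mul_left_comm] }
  map_add' v v' := by
    refine LinearMap.ext fun F => funext fun k => ?_
    cases k with
    | zero => simp
    | succ k =>
      simp only [LinearMap.add_apply, Pi.add_apply, LinearMap.coe_mk, AddHom.coe_mk]
      rw [← map_add]; congr 1; funext w; simp [ten, add_mul, lett]
  map_smul' r v := by
    refine LinearMap.ext fun F => funext fun k => ?_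
    cases k with
    | zero => simp
    | succ k =>
      simp only [LinearMap.smul_apply, Pi.smul_apply, LinearMap.coe_mk, AddHom.coe_mk,
        RingHom.id_apply]
      rw [← map_smul]; congr 1; funext w; simp [ten, mul_assoc, lett]

theorem ell_zero (v : V) (F : ℕ → (ℤ → ι) → K) : ell b q M v F 0 = 0 := rfl
theorem ell_succ (v : V) (F : ℕ → (ℤ → ι) → K) (k : ℕ) : ell b q M v F (k + 1) =
    asym q (fwd M 0) (k + 1) (ten 1 (lett b v) (inf K ι k (res K ι k (F k)))) := rfl

theorem asym0_mem (k : ℕ) (f : (ℤ → ι) → K) (hf : f ∈ Xs K ι k) :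
    asym q (fwd M 0) k f ∈ Xs K ι k := by
  have := asym_fwd_pres (q := q) (M := M) k 0 k (by omega); simpa using this f hf

theorem asym_absorb (hq : ∀ k, 1 ≤ k → qn q k ≠ 0) (H : HR q (fwd M 0)) (k : ℕ)
    (u y : (ℤ → ι) → K) (hu : u ∈ Xs K ι 1) :
    asym q (fwd M 0) (k + 1) (ten 1 u (asym q (fwd M 0) k y)) =
      asym q (fwd M 0) (k + 1) (ten 1 u y) := by
  rw [← asym_ten_right 1 k u y hu]
  refine asym_fix_right hq _ k (fun m hm y => ?_) _
  have := asym_kill_right hq H (k + 1) (m + 1) (by omega) y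
  rw [← this]; congr 2; simp only [fwd]; congr 1; push_cast; ring

theorem ell_ell (hq : ∀ k, 1 ≤ k → qn q k ≠ 0) (H : HR q (fwd M 0)) (v v' : V)
    (F : ℕ → (ℤ → ι) → K) (k : ℕ) : ell b q M v (ell b q M v' F) (k + 2) =
    asym q (fwd M 0) (k + 2) (ten 1 (lett b v) (ten 1 (lett b v') (inf K ι k (res K ι k (F k))))) := by
  rw [ell_succ, ell_succ, inf_res, asym_absorb hq H _ _ _ (lett_mem b v)]
  refine asym0_mem _ _ ?_
  rw [add_comm]; exact ten_mem (lett_mem b v') (inf_mem _ _)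

/-- the representation of the tensor algebra -/
noncomputable def rho (q : K) (M : ι → ι → ι → ι → K) :
    TensorAlgebra K V →ₐ[K] Module.End K (ℕ → (ℤ → ι) → K) :=
  TensorAlgebra.lift K (ell b q M)

theorem T0_ten {b : Module.Basis ι K V} (c d : ι) (G : (ℤ → ι) → K) (k : ℕ) (hG : G ∈ Xs K ι k) :
    Tz M 0 (ten 1 (lett b (b c)) (ten 1 (lett b (b d)) G)) =
      ∑ x, ∑ y, M x y c d • ten 1 (lett b (b x)) (ten 1 (lett b (b y)) G) := by
  funext w
  simp only [Finset.sum_apply, Pi.smul_apply, Tz_apply, ten, lett, smul_eq_mul]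
  rw [Finset.sum_eq_single c, Finset.sum_eq_single d, Finset.sum_eq_single (w 0),
    Finset.sum_eq_single (w 1)]
  · simp only [Module.Basis.repr_self, Finsupp.single_apply, u2_apply]
    simp only [Nat.cast_one, zero_add, if_true, one_mul]
    congr 1
    simp
    refine hG _ _ fun i h0 h1 => ?_
    rw [if_neg (by omega), if_neg (by omega)]
  · intro y _ hy
    simp [Finsupp.single_apply, hy]
  · simp
  · intro y _ hy
    simp [Finsupp.single_apply, hy]
  · simp
  · intro y _ hy
    simp [Finsupp.single_apply, u2_apply, hy.symm]
  · simp
  · intro y _ hy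
    simp [Finsupp.single_apply, u2_apply, hy.symm]
  · simp

theorem rho_rel {b : Module.Basis ι K V} (hq : ∀ k, 1 ≤ k → qn q k ≠ 0) (H : HR q (fwd M 0))
    (h : Rep b R M) (t : V ⊗[K] V) : rho b q M (quadMul K V ((R + LinearMap.id : V ⊗[K] V →ₗ[K] V ⊗[K] V) t)) = 0 := by
  have : (rho b q M).toLinearMap ∘ₗ quadMul K V ∘ₗ (R + LinearMap.id) = 0 := by
    refine (b.tensorProduct b).ext ?_
    rintro ⟨c, d⟩
    simp only [Module.Basis.tensorProduct_apply, LinearMap.comp_apply, LinearMap.add_apply,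
      LinearMap.id_apply, h c d, map_add, map_sum, map_smul, quadMul_tmul,
      AlgHom.toLinearMap_apply, map_mul, rho, TensorAlgebra.lift_ι_apply, LinearMap.zero_apply]
    refine LinearMap.ext fun F => funext fun k => ?_
    simp only [LinearMap.add_apply, LinearMap.sum_apply, LinearMap.smul_apply,
      Module.End.mul_apply, Pi.add_apply, Finset.sum_apply, Pi.smul_apply, LinearMap.zero_apply,
      Pi.zero_apply]
    match k with
    | 0 => simp [ell_zero]
    | 1 =>
      have : ∀ v v', ell b q M v (ell b q M v' F) 1 = 0 := fun v v' => by
        rw [ell_succ, ell_zero, map_zero, map_zero]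
        have : ten 1 (lett b v) (0 : (ℤ → ι) → K) = 0 := by funext w; simp [ten]
        rw [this, map_zero]
      simp [this]
    | k + 2 =>
      simp only [ell_ell b hq H]
      simp only [← map_smul, ← map_sum]
      rw [← T0_ten c d _ k (inf_mem _ _)]
      have := asym_kill_right hq H (k + 2) 0 (by omega)
        (ten 1 (lett b (b c)) (ten 1 (lett b (b d)) (inf K ι k (res K ι k (F k)))))
      rw [show fwd M 0 0 = Tz M 0 by simp [fwd]] at this
      rw [this, neg_add_cancel]
  exact congrArg (fun f => f t) this

theorem rho_monZ {b : Module.Basis ι K V} (hq : ∀ k, 1 ≤ k → qn q k ≠ 0) (H : HR q (fwd M 0))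
    (F : ℕ → (ℤ → ι) → K) (hF : F 0 = fun _ => 1) (k : ℕ) : ∀ f ∈ Xs K ι k,
    rho b q M (monZ b k f) F k = asym q (fwd M 0) k f := by
  induction k with
  | zero =>
    intro f hf
    rw [monZ_zero, map_smul, map_one, asym_zero_apply, LinearMap.smul_apply, Pi.smul_apply,
      Module.End.one_apply, hF]
    funext w
    simp only [Pi.smul_apply, smul_eq_mul, mul_one]
    exact hf _ _ fun i h0 h1 => by simp at h1; omega
  | succ k ih =>
    intro f hf
    rw [monZ_succ, map_sum, LinearMap.sum_apply, Finset.sum_apply]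
    conv_rhs => rw [← sum_ten_slice b k f hf, map_sum]
    refine Finset.sum_congr rfl fun c _ => ?_
    rw [map_mul, Module.End.mul_apply]
    have e : rho b q M (TensorAlgebra.ι K (b c)) = ell b q M (b c) := by
      rw [rho, TensorAlgebra.lift_ι_apply]
    have hm := slice_mem k c f hf
    rw [e, ell_succ, ih _ hm, inf_res _ _ (asym0_mem _ _ hm), asym_absorb hq H _ _ _ (lett_mem b _)]

theorem qpi_zero_iff {b : Module.Basis ι K V} (hq : ∀ k, 1 ≤ k → qn q k ≠ 0) (H : HR q (fwd M 0))
    (h : Rep b R M) (k : ℕ) (f : (ℤ → ι) → K) (hf : f ∈ Xs K ι k)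
    (h0 : qpi R (monZ b k f) = 0) : asym q (fwd M 0) k f = 0 := by
  have hr : ∀ ⦃x y⦄, quadRel K V (LinearMap.range (R + LinearMap.id)) x y →
      rho b q M x = rho b q M y := by
    rintro x y ⟨rfl, _, ⟨t, rfl⟩, rfl⟩
    rw [rho_rel hq H h, map_zero]
  let ρ := RingQuot.liftAlgHom K ⟨rho b q M, hr⟩
  have h1 : ∀ a, ρ (qpi R a) = rho b q M a := fun a => RingQuot.liftAlgHom_mkAlgHom_apply K _ hr a
  rw [← rho_monZ (b := b) hq H (fun _ _ => 1) rfl k f hf, ← h1, h0, map_zero]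
  rfl

theorem lambdaDim_eq {b : Module.Basis ι K V} (hq : ∀ k, 1 ≤ k → qn q k ≠ 0)
    (H : HR q (fwd M 0)) (h : Rep b R M) (k : ℕ) : lambdaDim K V R k = lam q M k := by
  let z := (qpi R).toLinearMap ∘ₗ monZ b k ∘ₗ inf K ι k
  have hz : lambdaDim K V R k = Module.finrank K (LinearMap.range z) := by
    rw [lambdaDim, quadDim, ← monZ_range b k]
    have : Xs K ι k = LinearMap.range (inf K ι k) := by
      refine le_antisymm (fun f hf => ⟨_, inf_res k f hf⟩) ?_
      rintro _ ⟨g, rfl⟩; exact inf_mem k g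
    rw [this, LinearMap.range_comp, LinearMap.range_comp]; rfl
  have hker : LinearMap.ker z = LinearMap.ker (cmp k (asym q (fwd M 0) k)) := by
    have hc : ∀ g, asym q (fwd M 0) k (inf K ι k g) ∈ Xs K ι k := fun g => asym0_mem _ _ (inf_mem _ _)
    ext g
    rw [LinearMap.mem_ker, LinearMap.mem_ker]
    constructor
    · intro hg
      have := qpi_zero_iff hq H h k _ (inf_mem k g) hg
      simp [cmp, this]
    · intro hg
      let T' : ℕ → Module.End K ((Fin k → ι) → K) := fun m => cmp k (fwd M 0 m)
      have hT : ∀ m, m + 1 < k → ∀ y ∈ (⊤ : Submodule K ((Fin k → ι) → K)),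
          T' m y ∈ (⊤ : Submodule K ((Fin k → ι) → K)) ∧
            fwd M 0 m (inf K ι k y) = inf K ι k (T' m y) := fun m hm y _ => ⟨trivial, by
          simp only [T', cmp, LinearMap.comp_apply]
          rw [inf_res]
          exact Tz_mem k _ (by omega) (by omega) _ (inf_mem _ _)⟩
      have h1 := (asym_nat (q := q) (T := fwd M 0) ⊤ (inf K ι k) k hT g trivial).2
      have h2 := asym_fix_right hq z k (T := T') (fun m hm y => by
        have := qpi_monZ h k m hm _ (inf_mem k y)
        simp only [z, LinearMap.comp_apply]
        rw [← (hT m hm y trivial).2]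
        simpa [fwd] using this) g
      rw [← h2]
      have h3 : asym q T' k g = 0 := by
        rw [← res_inf k (asym q T' k g), ← h1]; exact hg
      rw [h3, map_zero]
  have r1 := LinearMap.finrank_range_add_finrank_ker z
  have r2 := LinearMap.finrank_range_add_finrank_ker (cmp k (asym q (fwd M 0) k))
  rw [hker] at r1
  rw [hz, lam]
  omega

theorem sDim_eq {b : Module.Basis ι K V} (hq : ∀ k, 1 ≤ k → qn q k ≠ 0)
    (H : MH q M) (h : Rep b R M) (k : ℕ) : sDim K V q R k = lam q (Msh q M) k := by
  rw [← lambdaDim_eq hq (by rw [fwd_Msh]; exact sharp_HR (fwd_HR H 0)) (h.sharp (q := q))]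
  rw [sDim, lambdaDim]
  congr 1
  have : (q - 1) • LinearMap.id - R + LinearMap.id = - (R - q • LinearMap.id) := by module
  rw [this, LinearMap.range_neg]

end Link
end HeckeProof

set_option linter.unusedSectionVars false

namespace HeckeProof

section JM
variable {K : Type*} [Field K] {X : Type*} [AddCommGroup X] [Module K X]
variable {q : K} {T : ℕ → Module.End K X}

/-- Jucys–Murphy elements -/
noncomputable def JM (q : K) (T : ℕ → Module.End K X) : ℕ → Module.End K X
  | 0 => 0
  | i + 1 => q⁻¹ • (T i * JM q T i * T i + T i)

theorem JM_zero_apply (x : X) : JM q T 0 x = 0 := rfl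
theorem JM_succ_apply (i : ℕ) (x : X) :
    JM q T (i + 1) x = q⁻¹ • (T i (JM q T i (T i x)) + T i x) := rfl

theorem JM_succ_q (h0 : q ≠ 0) (i : ℕ) (x : X) :
    T i (JM q T i (T i x)) = q • JM q T (i + 1) x - T i x := by
  rw [JM_succ_apply, smul_inv_smul₀ h0]; abel

theorem JM_comm_low (Ψ : Module.End K X) (j : ℕ) (h : ∀ m, m < j → ∀ x, Ψ (T m x) = T m (Ψ x))
    (x : X) : Ψ (JM q T j x) = JM q T j (Ψ x) := by
  induction j generalizing x with
  | zero => simp [JM_zero_apply]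
  | succ j ih =>
    rw [JM_succ_apply, JM_succ_apply, map_smul, map_add, h j (by omega), h j (by omega),
      ih (fun m hm => h m (by omega)), h j (by omega)]

theorem JM_comm1 (H : HR q T) (i j : ℕ) (h : j < i) (x : X) :
    T i (JM q T j x) = JM q T j (T i x) :=
  JM_comm_low (T i) j (fun m hm x => (H.comm m i x (by omega)).symm) x

theorem JM_comm2 (h0 : q ≠ 0) (H : HR q T) (i j : ℕ) (x : X) :
    T i (JM q T (i + 2 + j) x) = JM q T (i + 2 + j) (T i x) := by
  induction j generalizing x with
  | succ j ih =>
    have hc : ∀ x, T (i + 2 + j) (T i x) = T i (T (i + 2 + j) x) :=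
      fun x => (H.comm i (i + 2 + j) x (by omega)).symm
    rw [← Nat.add_assoc, JM_succ_apply, JM_succ_apply, map_smul, map_add, hc, ← hc, ih]
  | zero =>
    rw [Nat.add_zero]
    have c1 : ∀ x, T (i + 1) (JM q T i x) = JM q T i (T (i + 1) x) := JM_comm1 H (i + 1) i (by omega)
    have e : ∀ x, JM q T (i + 2) x = q⁻¹ • (q⁻¹ • (T (i + 1) (T i (JM q T i (T i (T (i + 1) x))))
        + T (i + 1) (T i (T (i + 1) x))) + T (i + 1) x) := fun x => by
      rw [JM_succ_apply, JM_succ_apply, map_smul, map_add]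
    rw [e, e]
    simp only [map_smul, map_add]
    rw [H.braid i (JM q T i (T i (T (i + 1) x))), c1, ← H.braid i x]
    rw [H.quad i (T (i + 1) (T i x)), ← H.braid i (T i x)]
    rw [H.quad i x]
    simp only [map_smul, map_add]
    have : q⁻¹ * q = 1 := inv_mul_cancel₀ h0
    match_scalars <;> field_simp <;> ring

theorem JM_left (h0 : q ≠ 0) (H : HR q T) (i : ℕ) (x : X) :
    T i (JM q T (i + 1) x) = JM q T i (T i x) + x + (q - 1) • JM q T (i + 1) x := by
  rw [JM_succ_apply, map_smul, map_add, H.quad i, H.quad i]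
  match_scalars <;> field_simp <;> ring

theorem JM_right (h0 : q ≠ 0) (H : HR q T) (i : ℕ) (x : X) :
    JM q T (i + 1) (T i x) = T i (JM q T i x) + x + (q - 1) • JM q T (i + 1) x := by
  rw [JM_succ_apply, JM_succ_apply, H.quad i x]
  simp only [map_smul, map_add]
  match_scalars <;> field_simp <;> ring

/-- the intertwiner -/
noncomputable def itw (q : K) (T : ℕ → Module.End K X) (i : ℕ) (α β : K) : Module.End K X :=
  T i + ((1 + (q - 1) * β) / (α - β)) • 1

theorem itw_apply (i : ℕ) (α β : K) (x : X) :
    itw q T i α β x = T i x + ((1 + (q - 1) * β) / (α - β)) • x := rfl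

theorem itw_low (h0 : q ≠ 0) (H : HR q T) (i : ℕ) (α β : K) (hab : α ≠ β) (x : X)
    (h1 : JM q T i x = α • x) (h2 : JM q T (i + 1) x = β • x) :
    JM q T i (itw q T i α β x) = β • itw q T i α β x := by
  have e := JM_left h0 H i x
  rw [h2, map_smul] at e
  have e' : JM q T i (T i x) = β • T i x - x - (q - 1) • β • x := by rw [e]; abel
  have : α - β ≠ 0 := sub_ne_zero.mpr hab
  rw [itw_apply, map_add, map_smul, e', h1]
  match_scalars <;> field_simp <;> ring

theorem itw_high (h0 : q ≠ 0) (H : HR q T) (i : ℕ) (α β : K) (hab : α ≠ β) (x : X)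
    (h1 : JM q T i x = α • x) (h2 : JM q T (i + 1) x = β • x) :
    JM q T (i + 1) (itw q T i α β x) = α • itw q T i α β x := by
  have e := JM_right h0 H i x
  rw [h2, h1, map_smul] at e
  have : α - β ≠ 0 := sub_ne_zero.mpr hab
  rw [itw_apply, map_add, map_smul, e, h2]
  match_scalars <;> field_simp <;> ring

theorem itw_inj (h0 : q ≠ 0) (H : HR q T) (i : ℕ) (α β : K) (ha : α ≠ 1 + q * β)
    (hb : β ≠ 1 + q * α) (x : X)
    (h1 : JM q T i x = α • x) (h2 : JM q T (i + 1) x = β • x) (hx : itw q T i α β x = 0) :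
    x = 0 := by
  by_contra hne
  rw [itw_apply] at hx
  set γ := (1 + (q - 1) * β) / (α - β)
  have e : T i x = (-γ) • x := by rw [neg_smul]; exact eq_neg_of_add_eq_zero_left hx
  have e2 := H.quad i x
  rw [e, map_smul, e] at e2
  have e3 : ((-γ) * (-γ) - (q - 1) * (-γ) - q) • x = 0 := by
    have := sub_eq_zero.mpr e2
    rw [← this]; module
  have e4 := (smul_eq_zero.mp e3).resolve_right hne
  have e5 := JM_succ_q (T := T) h0 i x
  rw [e, map_smul, h1, map_smul, map_smul, e, h2] at e5
  have e6 : ((-γ) * α * (-γ) - q * β + (-γ)) • x = 0 := by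
    have := sub_eq_zero.mpr e5
    rw [← this]; module
  have e7 := (smul_eq_zero.mp e6).resolve_right hne
  have e8 : (γ - 1) * (γ + q) = 0 := by linear_combination e4
  rcases mul_eq_zero.mp e8 with h | h
  · have : γ = 1 := by linear_combination h
    rw [this] at e7
    exact ha (by linear_combination e7)
  · have : γ = -q := by linear_combination h
    rw [this] at e7
    refine hb (mul_left_cancel₀ h0 (by linear_combination -e7))

theorem JM_cc (h0 : q ≠ 0) (H : HR q T) (j : ℕ) : ∀ y, (∀ m, m + 1 < j → T m y = -y) →
    q ^ j • JM q T j y = q ^ j • y - cc q T j y := by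
  induction j with
  | zero => intro y _; simp [JM_zero_apply, cc_zero_apply]
  | succ j ih =>
    intro y hy
    have hz : ∀ m, m + 1 < j → T m (T j y) = - T j y := fun m hm => by
      rw [H.comm m j y (by omega), hy m (by omega), map_neg]
    have e := ih _ hz
    have key : T j (JM q T j (T j y)) = - JM q T j (T j y) := by
      cases j with
      | zero => simp [JM_zero_apply]
      | succ i =>
        have hq' : q ^ (i + 1) ≠ 0 := pow_ne_zero _ h0
        rw [cc_succ_apply, sub_sub_cancel] at e
        refine smul_right_injective _ hq' ?_
        simp only []
        rw [smul_neg, ← map_smul, e, ← cc_comm (T := T) (T (i + 1)) i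
          (fun m hm x => H.comm m (i + 1) x (by omega)), ← H.braid, hy i (by omega)]
        simp
    have e' : cc q T j (T j y) = q ^ j • T j y - q ^ j • JM q T j (T j y) := by rw [e]; abel
    rw [JM_succ_apply, key, cc_succ_apply, e']
    match_scalars <;> field_simp <;> ring

theorem JM_kill (h0 : q ≠ 0) (y : X) (j : ℕ) (e : ℕ → K) (e0 : e 0 = 0)
    (he : ∀ i, i < j → q * e (i + 1) + 1 = e i) (hy : ∀ m, m < j → T m y = -y) :
    JM q T j y = e j • y := by
  induction j with
  | zero => simp [JM_zero_apply, e0]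
  | succ j ih =>
    rw [JM_succ_apply, hy j (by omega), map_neg, ih (fun i hi => he i (by omega))
      (fun m hm => hy m (by omega)), map_neg, map_smul, hy j (by omega), ← he j (by omega)]
    match_scalars; field_simp; ring

theorem JM_sym (h0 : q ≠ 0) (y : X) (j : ℕ) (hy : ∀ m, m < j → T m y = q • y) :
    JM q T j y = qn q j • y := by
  induction j with
  | zero => simp [JM_zero_apply, qn_zero]
  | succ j ih =>
    rw [JM_succ_apply, hy j (by omega), map_smul, ih (fun m hm => hy m (by omega)), map_smul,
      map_smul, hy j (by omega), qn_succ]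
    have := qn_geom q j
    match_scalars; field_simp; linear_combination this

theorem joint_indep {W : Type*} [DecidableEq W] (A : ℕ → Module.End K X) (e : W → ℕ → K) (N : ℕ)
    (s : Finset W) : ∀ x : W → X,
    (∀ w ∈ s, ∀ i, i < N → A i (x w) = e w i • x w) →
    (∀ w ∈ s, ∀ w' ∈ s, w ≠ w' → ∃ i, i < N ∧ e w i ≠ e w' i) →
    ∑ w ∈ s, x w = 0 → ∀ w ∈ s, x w = 0 := by
  induction s using Finset.induction_on with
  | empty => intro x _ _ _ w hw; simp at hw
  | insert w0 s h0 ih =>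
    intro x hx hd hs
    rw [Finset.sum_insert h0] at hs
    have h1 : ∀ w ∈ s, x w = 0 := by
      intro w hw
      obtain ⟨i, hi, hne⟩ := hd w (Finset.mem_insert_of_mem hw) w0 (Finset.mem_insert_self _ _)
        (fun h => h0 (h ▸ hw))
      have h2 := ih (fun w => (e w i - e w0 i) • x w)
        (fun w hw i hi => by
          rw [map_smul, hx w (Finset.mem_insert_of_mem hw) i hi, smul_comm])
        (fun w hw w' hw' => hd w (Finset.mem_insert_of_mem hw) w' (Finset.mem_insert_of_mem hw'))
        (by
          have := congrArg (fun z => A i z - e w0 i • z) hs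
          simp only [map_add, map_sum, smul_add, map_zero, smul_zero, sub_zero,
            hx w0 (Finset.mem_insert_self _ _) i hi, Finset.smul_sum] at this
          rw [add_sub_add_left_eq_sub, ← Finset.sum_sub_distrib] at this
          rw [← this]
          refine Finset.sum_congr rfl fun w hw => ?_
          rw [hx w (Finset.mem_insert_of_mem hw) i hi, sub_smul]) w hw
      exact (smul_eq_zero.mp h2).resolve_left (sub_ne_zero.mpr hne)
    intro w hw
    rcases Finset.mem_insert.mp hw with rfl | hw
    · rwa [Finset.sum_eq_zero h1, add_zero] at hs
    · exact h1 w hw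

end JM

end HeckeProof

set_option linter.unusedSectionVars false

namespace HeckeProof

section Words

/-- lattice words; the head is the last letter -/
def Lat (n : ℕ) : List ℕ → Prop
  | [] => True
  | a :: t => Lat n t ∧ a < n ∧ ∀ r, r < a → t.count a < t.count r

theorem lat_cons {n a : ℕ} {t : List ℕ} :
    Lat n (a :: t) ↔ Lat n t ∧ a < n ∧ ∀ r, r < a → t.count a < t.count r := Iff.rfl

theorem lat_lt {n : ℕ} {t : List ℕ} (h : Lat n t) : ∀ a ∈ t, a < n := by
  induction t with
  | nil => simp
  | cons b t ih =>
    intro a ha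
    rcases List.mem_cons.mp ha with rfl | ha
    · exact h.2.1
    · exact ih h.1 a ha

theorem lat_mono {n : ℕ} {t : List ℕ} (h : Lat n t) (r s : ℕ) (hrs : r < s) :
    t.count s ≤ t.count r := by
  induction t with
  | nil => simp
  | cons b t ih =>
    have := ih h.1
    have h2 := h.2.2
    rw [List.count_cons, List.count_cons]
    by_cases hb : b = s
    · subst hb
      have := h2 r hrs
      simp; omega
    · simp [hb]; omega

theorem lat_cons_perm {n a : ℕ} {t t' : List ℕ} (h : Lat n (a :: t)) (p : t.Perm t')
    (h' : Lat n t') : Lat n (a :: t') :=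
  ⟨h', h.2.1, fun r hr => by rw [← p.count_eq, ← p.count_eq]; exact h.2.2 r hr⟩

theorem lat_cons_of_perm {n a : ℕ} {t s : List ℕ} (h : Lat n t) (p : t.Perm (a :: s))
    (h' : Lat n s) : Lat n (a :: s) :=
  ⟨h', lat_lt h a (p.mem_iff.mpr (by simp)), fun r hr => by
    have := lat_mono h r a hr
    rw [p.count_eq, p.count_eq, List.count_cons_self, List.count_cons_of_ne (by omega)] at this
    omega⟩

theorem lat_remove {n b : ℕ} {t : List ℕ} (h : Lat n t) (hb : b ∈ t)
    (hr : ∀ r, b < r → t.count r < t.count b) : ∃ s, Lat n s ∧ t.Perm (b :: s) := by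
  induction t with
  | nil => simp at hb
  | cons c t ih =>
    by_cases hc : c = b
    · subst hc; exact ⟨t, h.1, List.Perm.refl _⟩
    · have hb' : b ∈ t := by
        rcases List.mem_cons.mp hb with h | h
        · exact absurd h.symm hc
        · exact h
      obtain ⟨s, hs, p⟩ := ih h.1 hb' (fun r hbr => by
        have := hr r hbr
        rw [List.count_cons, List.count_cons_of_ne hc] at this
        omega)
      refine ⟨c :: s, ⟨hs, h.2.1, fun r hrc => ?_⟩, (p.cons c).trans (List.Perm.swap _ _ _)⟩
      have h1 := h.2.2 r hrc
      rw [p.count_eq, p.count_eq, List.count_cons_of_ne (Ne.symm hc)] at h1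
      by_cases hrb : r = b
      · subst hrb
        have := hr c hrc
        rw [List.count_cons_self, List.count_cons_of_ne hc, p.count_eq, p.count_eq,
          List.count_cons_self, List.count_cons_of_ne (Ne.symm hc)] at this
        omega
      · rwa [List.count_cons_of_ne (Ne.symm hrb)] at h1

/-- admissible adjacent swap -/
def LStep (n : ℕ) (w w' : List ℕ) : Prop :=
  ∃ s a b t, a ≠ b ∧ Lat n (a :: t) ∧ Lat n (b :: t) ∧ w = s ++ a :: b :: t ∧
    w' = s ++ b :: a :: t

theorem LStep_cons {n c : ℕ} {w w' : List ℕ} (h : LStep n w w') : LStep n (c :: w) (c :: w') := by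
  obtain ⟨s, a, b, t, h1, h2, h3, rfl, rfl⟩ := h
  exact ⟨c :: s, a, b, t, h1, h2, h3, rfl, rfl⟩

theorem lat_connected {n : ℕ} (w w' : List ℕ) (h : Lat n w) (h' : Lat n w') (p : w.Perm w') :
    Relation.ReflTransGen (LStep n) w w' := by
  induction hN : w.length generalizing w w' with
  | zero =>
    have : w = [] := List.length_eq_zero_iff.mp hN
    subst this
    rw [List.nil_perm.mp p]
  | succ N ih =>
    obtain ⟨a, t, rfl⟩ : ∃ a t, w = a :: t := by
      cases w with
      | nil => simp at hN
      | cons a t => exact ⟨a, t, rfl⟩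
    obtain ⟨b, t', rfl⟩ : ∃ a t, w' = a :: t := by
      cases w' with
      | nil => simp at p
      | cons a t => exact ⟨a, t, rfl⟩
    have lift : ∀ c u u', Lat n u → Lat n u' → u.Perm u' → u.length = N →
        Relation.ReflTransGen (LStep n) (c :: u) (c :: u') := fun c u u' hu hu' hp hl =>
      Relation.ReflTransGen.lift (fun x => c :: x) (fun _ _ => LStep_cons) _ _ (ih u u' hu hu' hp hl)
    have hl : t.length = N := by simpa using hN
    by_cases hab : a = b
    · subst hab
      exact lift a t t' h.1 h'.1 ((List.perm_cons a).mp p) hl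
    · have hbt : b ∈ t := by
        have : b ∈ a :: t := p.mem_iff.mpr (by simp)
        rcases List.mem_cons.mp this with h | h
        · exact absurd h.symm hab
        · exact h
      obtain ⟨s, hs, ps⟩ := lat_remove h.1 hbt (fun r hr => by
        have e1 := p.count_eq r
        have e2 := p.count_eq b
        rw [List.count_cons_of_ne hab, List.count_cons_self] at e2
        rw [List.count_cons, List.count_cons_of_ne (by omega)] at e1
        have := lat_mono h'.1 b r hr
        omega)
      have pt' : t'.Perm (a :: s) := by
        have h1 : (b :: t').Perm (b :: a :: s) :=
          p.symm.trans ((ps.cons a).trans (List.Perm.swap _ _ _))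
        exact (List.perm_cons b).mp h1
      have v1 : Lat n (b :: s) := lat_cons_of_perm h.1 ps hs
      have v2 : Lat n (a :: s) := lat_cons_of_perm h'.1 pt' hs
      have l' : t'.length = N := by
        have := p.length_eq; simp at this; omega
      have r1 := lift a t (b :: s) h.1 v1 ps hl
      have r2 := lift b (a :: s) t' v2 h'.1 pt'.symm (by rw [← pt'.length_eq, l'])
      exact (r1.tail ⟨[], a, b, s, hab, v2, v1, rfl, rfl⟩).trans r2

/-- shifted contents -/
def cf (n : ℕ) : List ℕ → ℕ → ℕ
  | [], _ => 0
  | a :: t, i => if i = t.length then t.count a + (n - 1 - a) else cf n t i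

theorem cf_distinct {n : ℕ} (w w' : List ℕ) (h : Lat n w) (h' : Lat n w') (hl : w.length = w'.length)
    (hne : w ≠ w') : ∃ i, i < w.length ∧ cf n w i ≠ cf n w' i := by
  induction w generalizing w' with
  | nil => exact absurd (List.length_eq_zero_iff.mp hl.symm).symm hne
  | cons a t ih =>
    cases w' with
    | nil => simp at hl
    | cons b t' =>
      have hl' : t.length = t'.length := by simpa using hl
      by_cases ht : t = t'
      · subst ht
        refine ⟨t.length, by simp, ?_⟩
        have hab : a ≠ b := fun e => hne (by rw [e])
        simp only [cf, if_true]
        have ha := h.2.1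
        have hb := h'.2.1
        rcases lt_or_gt_of_ne hab with hlt | hlt
        · have := h'.2.2 a hlt; omega
        · have := h.2.2 b hlt; omega
      · obtain ⟨i, hi, hc⟩ := ih t' h.1 h'.1 hl' ht
        refine ⟨i, by simp; omega, ?_⟩
        simp only [cf]
        rw [if_neg (by omega), if_neg (by omega)]
        exact hc

/-- a column -/
def colm : ℕ → List ℕ
  | 0 => []
  | m + 1 => m :: colm m

theorem colm_length (m : ℕ) : (colm m).length = m := by
  induction m with
  | zero => rfl
  | succ m ih => simp [colm, ih]

theorem colm_count (m a : ℕ) : (colm m).count a = if a < m then 1 else 0 := by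
  induction m with
  | zero => simp [colm]
  | succ m ih =>
    rw [colm, List.count_cons, ih]
    by_cases h : m = a
    · subst h; simp
    · simp only [beq_iff_eq, h, if_false]
      by_cases h2 : a < m
      · rw [if_pos h2, if_pos (by omega)]
      · rw [if_neg h2, if_neg (by omega)]

theorem colm_lat (n m : ℕ) (h : m ≤ n) : Lat n (colm m) := by
  induction m with
  | zero => trivial
  | succ m ih =>
    refine ⟨ih (by omega), by omega, fun r hr => ?_⟩
    rw [colm_count, colm_count, if_neg (by omega), if_pos hr]; exact one_pos

theorem colm_cf (n m i : ℕ) (h : i < m) : cf n (colm m) i = n - 1 - i := by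
  induction m with
  | zero => omega
  | succ m ih =>
    simp only [colm, cf, colm_length, colm_count]
    split
    · subst i; simp
    · exact ih (by omega)

theorem app_lat (n : ℕ) (t : List ℕ) (h : Lat n t) : Lat n (t ++ colm n) := by
  induction t with
  | nil => exact colm_lat n n le_rfl
  | cons a t ih =>
    refine ⟨ih h.1, h.2.1, fun r hr => ?_⟩
    have := h.2.2 r hr
    have := h.2.1
    change List.count a (t ++ colm n) < List.count r (t ++ colm n)
    rw [List.count_append, List.count_append, colm_count, colm_count, if_pos (by omega),
      if_pos (by omega)]
    omega

theorem app_cf (n : ℕ) (t : List ℕ) (h : Lat n t) (i : ℕ) (hi : i < t.length + n) :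
    cf n (t ++ colm n) i = if i < n then n - 1 - i else cf n t (i - n) + 1 := by
  induction t with
  | nil =>
    have : i < n := by simpa using hi
    rw [if_pos this]; exact colm_cf n n i this
  | cons a t ih =>
    simp only [List.cons_append, cf, List.length_append, colm_length, List.count_append, colm_count]
    have h1 := h.2.1
    rw [if_pos h1]
    simp only [List.length_cons] at hi
    by_cases hi' : i = t.length + n
    · rw [if_pos hi', if_neg (by omega), if_pos (by omega)]; omega
    · rw [if_neg hi', ih h.1 (by omega)]
      split
      · rfl
      · rw [if_neg (by omega)]

/-- the initial word -/
def w0 (n k : ℕ) : ℕ → List ℕ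
  | 0 => List.replicate k 0
  | r + 1 => w0 n k r ++ colm n

theorem w0_lat (n k r : ℕ) (hn : 1 ≤ n) : Lat n (w0 n k r) := by
  induction r with
  | zero =>
    simp only [w0]
    induction k with
    | zero => trivial
    | succ k ih => exact ⟨ih, by omega, fun r hr => by omega⟩
  | succ r ih => exact app_lat n _ ih

theorem w0_length (n k r : ℕ) : (w0 n k r).length = n * r + k := by
  induction r with
  | zero => simp [w0]
  | succ r ih => simp [w0, ih, colm_length]; ring

theorem w0_count (n k r a : ℕ) : (w0 n k r).count a = (if a < n then r else 0) +
    (if a = 0 then k else 0) := by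
  induction r with
  | zero =>
    simp only [w0, List.count_replicate, beq_iff_eq, ite_self, zero_add]
    by_cases h : a = 0
    · subst h; simp
    · rw [if_neg h, if_neg (Ne.symm h)]
  | succ r ih =>
    simp only [w0, List.count_append, ih, colm_count]
    split <;> omega

theorem rep_cf (n k i : ℕ) (h : i < k) : cf n (List.replicate k 0) i = i + (n - 1) := by
  induction k with
  | zero => omega
  | succ k ih =>
    simp only [List.replicate_succ, cf, List.length_replicate, List.count_replicate_self]
    split
    · subst i; simp
    · exact ih (by omega)

end Words

end HeckeProof

set_option linter.unusedSectionVars false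

namespace HeckeProof

section Content
variable {K : Type*} [Field K] {q : K}

theorem qn_add (p d : ℕ) : qn q (p + d) = qn q p + q ^ p * qn q d := by
  induction d with
  | zero => simp [qn_zero]
  | succ d ih => rw [← Nat.add_assoc, qn_succ, ih, qn_succ, pow_add]; ring

theorem qn_succ' (p : ℕ) : qn q (p + 1) = 1 + q * qn q p := by
  rw [Nat.add_comm, qn_add, qn_one, pow_one]

/-- content eigenvalue -/
noncomputable def ct (q : K) (n p : ℕ) : K := (qn q p - qn q (n - 1)) / q ^ (n - 1)

theorem ct_succ (h0 : q ≠ 0) (n p : ℕ) : ct q n (p + 1) = 1 + q * ct q n p := by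
  have h : q ^ (n - 1) ≠ 0 := pow_ne_zero _ h0
  have h1 := qn_succ q (n - 1)
  rw [qn_succ'] at h1
  unfold ct
  rw [qn_succ']
  field_simp
  linear_combination h1

theorem ct_base (n : ℕ) : ct q n (n - 1) = 0 := by simp [ct]

theorem qn_inj (h0 : q ≠ 0) (hq : ∀ k, 1 ≤ k → qn q k ≠ 0) (p p' : ℕ) (h : qn q p = qn q p') :
    p = p' := by
  wlog hle : p ≤ p' generalizing p p'
  · exact (this p' p h.symm (by omega)).symm
  obtain ⟨d, rfl⟩ := Nat.exists_eq_add_of_le hle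
  rw [qn_add] at h
  by_contra hne
  have h2 : q ^ p * qn q d = 0 := by linear_combination -h
  exact mul_ne_zero (pow_ne_zero _ h0) (hq d (by omega)) h2

theorem ct_inj (h0 : q ≠ 0) (hq : ∀ k, 1 ≤ k → qn q k ≠ 0) (n p p' : ℕ)
    (h : ct q n p = ct q n p') : p = p' := by
  have h1 : q ^ (n - 1) ≠ 0 := pow_ne_zero _ h0
  unfold ct at h
  rw [div_left_inj' h1] at h
  exact qn_inj h0 hq p p' (by linear_combination h)

theorem cf_app (n : ℕ) (s t : List ℕ) (i : ℕ) (h : i < t.length) : cf n (s ++ t) i = cf n t i := by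
  induction s with
  | nil => rfl
  | cons a s ih =>
    simp only [List.cons_append, cf, List.length_append]
    rw [if_neg (by omega), ih]

theorem cf_swap (n : ℕ) (s t : List ℕ) (a b i : ℕ) (h : i ≠ t.length) (h' : i ≠ t.length + 1) :
    cf n (s ++ a :: b :: t) i = cf n (s ++ b :: a :: t) i := by
  induction s with
  | nil => simp [cf, h, h']
  | cons c s ih =>
    simp only [List.cons_append, cf, List.length_append, List.length_cons, ih]
    rw [List.Perm.count_eq (List.Perm.append_left s (List.Perm.swap b a t))]

end Content

section Base
variable {K : Type*} [Field K] {X : Type*} [AddCommGroup X] [Module K X]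
variable {q : K} {T : ℕ → Module.End K X}

/-- joint eigenvector -/
def JE (q : K) (T : ℕ → Module.End K X) (n : ℕ) (w : List ℕ) (x : X) : Prop :=
  ∀ i, i < w.length → JM q T i x = ct q n (cf n w i) • x

theorem JE_step (h0 : q ≠ 0) (hq : ∀ k, 1 ≤ k → qn q k ≠ 0) (H : HR q T) (n : ℕ) (w w' : List ℕ)
    (h : LStep n w w') : ∃ i α β, i + 1 < w.length ∧ ∀ x, JE q T n w x →
      JE q T n w' (itw q T i α β x) ∧ (itw q T i α β x = 0 → x = 0) := by
  obtain ⟨s, a, b, t, hab, ha, hb, rfl, rfl⟩ := h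
  set pa := t.count a + (n - 1 - a) with hpa
  set pb := t.count b + (n - 1 - b) with hpb
  have hd : pa + 2 ≤ pb ∨ pb + 2 ≤ pa := by
    have := ha.2.1
    have := hb.2.1
    rcases lt_or_gt_of_ne hab with hlt | hlt
    · have := hb.2.2 a hlt; omega
    · have := ha.2.2 b hlt; omega
  refine ⟨t.length, ct q n pb, ct q n pa, by simp; omega, fun x hx => ?_⟩
  have l1 : ∀ c d : ℕ, cf n (s ++ c :: d :: t) t.length = t.count d + (n - 1 - d) := fun c d => by
    rw [cf_app _ _ _ _ (by simp)]; simp [cf]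
  have l2 : ∀ c d : ℕ, c ≠ d → cf n (s ++ c :: d :: t) (t.length + 1) = t.count c + (n - 1 - c) :=
    fun c d hcd => by
      rw [cf_app _ _ _ _ (by simp)]; simp [cf, List.count_cons_of_ne hcd.symm]
  have e1 : JM q T t.length x = ct q n pb • x := by rw [hx _ (by simp; omega), l1]
  have e2 : JM q T (t.length + 1) x = ct q n pa • x := by rw [hx _ (by simp; omega), l2 a b hab]
  have hne : ct q n pb ≠ ct q n pa := fun h => by have := ct_inj h0 hq n _ _ h; omega
  have hne1 : ct q n pb ≠ 1 + q * ct q n pa := fun h => by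
    rw [← ct_succ h0] at h; have := ct_inj h0 hq n _ _ h; omega
  have hne2 : ct q n pa ≠ 1 + q * ct q n pb := fun h => by
    rw [← ct_succ h0] at h; have := ct_inj h0 hq n _ _ h; omega
  refine ⟨fun j hj => ?_, itw_inj h0 H _ _ _ hne1 hne2 x e1 e2⟩
  by_cases hj1 : j = t.length
  · subst hj1; rw [l1 b a, itw_low h0 H _ _ _ hne x e1 e2]
  by_cases hj2 : j = t.length + 1
  · subst hj2; rw [l2 b a hab.symm, itw_high h0 H _ _ _ hne x e1 e2]
  rw [← cf_swap n s t a b j hj1 hj2]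
  have e3 := hx j (by simp at hj ⊢; omega)
  have c : T t.length (JM q T j x) = JM q T j (T t.length x) := by
    rcases lt_or_ge j t.length with h | h
    · exact JM_comm1 H _ _ h x
    · obtain ⟨d, rfl⟩ := Nat.exists_eq_add_of_le (show t.length + 2 ≤ j by omega)
      exact JM_comm2 h0 H _ _ x
  rw [itw_apply, map_add, map_smul, ← c, e3, map_smul, smul_add, smul_comm]

end Base

section Bound
variable {K : Type*} [Field K] {ι : Type*} [Fintype ι] [DecidableEq ι] [Inhabited ι]
variable {q : K} {M : ι → ι → ι → ι → K}

theorem asym_zero_of_lam (N : ℕ) (h : lam q M N = 0) (f : (ℤ → ι) → K) :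
    asym q (fwd M 0) N f = 0 := by
  have h1 : ∀ f ∈ Xs K ι N, asym q (fwd M 0) N f = 0 := fun f hf => by
    have h2 : cmp N (asym q (fwd M 0) N) = 0 :=
      LinearMap.range_eq_bot.mp (Submodule.finrank_eq_zero.mp h)
    have h3 := congrArg (fun A => inf K ι N (A (res K ι N f))) h2
    simp only [cmp, LinearMap.comp_apply, inf_res N f hf, LinearMap.zero_apply, map_zero] at h3
    rwa [inf_res N _ (asym0_mem N f hf)] at h3
  funext v
  let fz : (ℤ → ι) → (ℤ → ι) := fun w i => if 0 ≤ i ∧ i < N then w i else v i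
  let Ψ : Module.End K ((ℤ → ι) → K) :=
    { toFun := fun f w => f (fz w)
      map_add' := fun _ _ => rfl
      map_smul' := fun _ _ => rfl }
  have hv : fz v = v := by funext i; simp [fz]
  have hc := asym_comm (q := q) (T := fwd M 0) Ψ N (fun m hm y => by
    funext w
    change Tz M _ (Ψ y) w = Tz M _ y (fz w)
    simp only [Tz_apply]
    have g1 : fz w (0 + m) = w (0 + m) := if_pos (by omega)
    have g2 : fz w (0 + m + 1) = w (0 + m + 1) := if_pos (by omega)
    rw [g1, g2]
    refine Finset.sum_congr rfl fun c _ => Finset.sum_congr rfl fun d _ => ?_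
    congr 1
    change y (fz (u2 _ w c d)) = y _
    congr 1
    funext i
    simp only [fz, u2_apply]
    split_ifs <;> first | rfl | omega) f
  have := congrFun hc v
  rw [h1 (Ψ f) (fun w w' hw => by
    change f (fz w) = f (fz w')
    congr 1; funext i; simp only [fz]
    split_ifs with hi
    · exact hw i hi.1 hi.2
    · rfl)] at this
  change 0 = asym q (fwd M 0) N f (fz v) at this
  rw [hv] at this
  exact this.symm

theorem fwd_ten_right {j : ℕ} {u y : (ℤ → ι) → K} (hu : u ∈ Xs K ι j) (i : ℕ) :
    fwd M 0 (j + i) (ten j u y) = ten j u (fwd M 0 i y) := by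
  have := Tz_ten_right (M := M) (y := y) hu i (by omega)
  simpa [fwd] using this

theorem fwd_mem {N i : ℕ} {y : (ℤ → ι) → K} (hy : y ∈ Xs K ι N) (h : i + 1 < N) :
    fwd M 0 i y ∈ Xs K ι N := Tz_mem N _ (by omega) (by omega) y hy

theorem ten_smul' (j : ℕ) (u y : (ℤ → ι) → K) (r : K) : ten j u (r • y) = r • ten j u y := by
  funext w; simp [ten, mul_left_comm]
theorem ten_add' (j : ℕ) (u y y' : (ℤ → ι) → K) : ten j u (y + y') = ten j u y + ten j u y' := by
  funext w; simp [ten, mul_add]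

theorem ten_kill {n N : ℕ} {u y : (ℤ → ι) → K} (hk : ∀ m, m + 1 < n → fwd M 0 m u = -u)
    (hy : y ∈ Xs K ι N) (m : ℕ) (hm : m + 1 < n) :
    fwd M 0 m (ten n u y) = - ten n u y := by
  have h1 : fwd M 0 m (ten n u y) = ten n (fwd M 0 m u) y := Tz_ten_left hy _ (by omega)
  rw [h1, hk m hm]; funext w; simp [ten]

theorem JM_top (h0 : q ≠ 0) (hq : ∀ k, 1 ≤ k → qn q k ≠ 0) (H : HR q (fwd M 0)) {n N : ℕ}
    (hl : lam q M (n + 1) = 0)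
    {u y : (ℤ → ι) → K} (hk : ∀ m, m + 1 < n → fwd M 0 m u = -u) (hy : y ∈ Xs K ι N) :
    JM q (fwd M 0) n (ten n u y) = ten n u y := by
  have k1 := ten_kill hk hy
  have h1 := asym_zero_of_lam (n + 1) hl (ten n u y)
  rw [asym_succ_apply, asym_fix hq n _ k1] at h1
  have h2 := (smul_eq_zero.mp h1).resolve_left (inv_ne_zero (hq (n + 1) (by omega)))
  have h3 := JM_cc h0 H n _ k1
  rw [h2, sub_zero] at h3
  exact smul_right_injective _ (pow_ne_zero n h0) h3

theorem JM_shift (h0 : q ≠ 0) (hq : ∀ k, 1 ≤ k → qn q k ≠ 0) (H : HR q (fwd M 0)) {n N : ℕ}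
    (hl : lam q M (n + 1) = 0) {u : (ℤ → ι) → K} (hu : u ∈ Xs K ι n)
    (hk : ∀ m, m + 1 < n → fwd M 0 m u = -u) (i : ℕ) : ∀ y ∈ Xs K ι N, i < N →
    JM q (fwd M 0) (n + i) (ten n u y) = ten n u (y + q • JM q (fwd M 0) i y) := by
  induction i with
  | zero => intro y hy _; rw [JM_zero_apply, smul_zero, add_zero y]; exact JM_top h0 hq H hl hk hy
  | succ i ih =>
    intro y hy hi
    rw [← Nat.add_assoc, JM_succ_apply, fwd_ten_right hu, ih _ (fwd_mem hy hi) (by omega),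
      fwd_ten_right hu, map_add, map_smul, H.quad, JM_succ_apply]
    simp only [ten_add', ten_smul']
    match_scalars <;> field_simp <;> ring

/-- the transported multiplicity space -/
def MS (q : K) (M : ι → ι → ι → ι → K) (n k N : ℕ) (w : List ℕ) : Prop :=
  ∃ φ : (Fin (lam q (Msh q M) k) → K) →ₗ[K] ((ℤ → ι) → K), Function.Injective φ ∧
    ∀ y, φ y ∈ Xs K ι N ∧ JE q (fwd M 0) n w (φ y)

theorem MS_step (h0 : q ≠ 0) (hq : ∀ k, 1 ≤ k → qn q k ≠ 0) (H : HR q (fwd M 0)) {n k N : ℕ}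
    {w w' : List ℕ} (h : LStep n w w') (hw : w.length = N) (hM : MS q M n k N w) :
    MS q M n k N w' := by
  obtain ⟨φ, hi, hφ⟩ := hM
  obtain ⟨i, α, β, hlt, hs⟩ := JE_step h0 hq H n w w' h
  refine ⟨itw q (fwd M 0) i α β ∘ₗ φ, ?_, fun y => ⟨?_, (hs _ (hφ y).2).1⟩⟩
  · rw [injective_iff_map_eq_zero]
    intro y hy
    have := (hs _ (hφ y).2).2 hy
    exact hi (by rw [this, map_zero])
  · rw [LinearMap.comp_apply, itw_apply]
    exact Submodule.add_mem _ (fwd_mem (hφ y).1 (by omega)) (Submodule.smul_mem _ _ (hφ y).1)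

theorem exists_u (H : HR q (fwd M 0)) {n : ℕ} (hl : lam q M n = 1) :
    ∃ u ∈ Xs K ι n, u ≠ 0 ∧ ∀ m, m + 1 < n → fwd M 0 m u = -u := by
  have h1 : cmp n (asym q (fwd M 0) n) ≠ 0 := fun h => by
    rw [lam, h, LinearMap.range_zero, finrank_bot] at hl; omega
  obtain ⟨g, hg⟩ : ∃ g, cmp n (asym q (fwd M 0) n) g ≠ 0 := by
    by_contra hc; push Not at hc; exact h1 (LinearMap.ext hc)
  refine ⟨asym q (fwd M 0) n (inf K ι n g), asym0_mem n _ (inf_mem n g), fun h => hg ?_, ?_⟩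
  · simp [cmp, h]
  · intro m hm; exact kill_asym H n _ m hm

theorem ten_inj {n N : ℕ} {u : (ℤ → ι) → K} (hu : u ∈ Xs K ι n) (hu0 : u ≠ 0)
    {y : (ℤ → ι) → K} (hy : y ∈ Xs K ι N) (h : ten n u y = 0) : y = 0 := by
  obtain ⟨w, hw⟩ : ∃ w, u w ≠ 0 := by
    by_contra hc; push Not at hc; exact hu0 (funext hc)
  funext v
  have h1 := congrFun h (fun i => if i < n then w i else v (i - n))
  simp only [ten, Pi.zero_apply] at h1
  rw [hu _ w (fun i _ hi => if_pos hi)] at h1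
  have h2 := (mul_eq_zero.mp h1).resolve_left hw
  rw [hy _ v (fun i hi _ => by rw [if_neg (by omega)]; congr 1; ring)] at h2
  exact h2

theorem MS_base (h0 : q ≠ 0) (hq : ∀ k, 1 ≤ k → qn q k ≠ 0) (H : MH q M) {n : ℕ} (hn : 1 ≤ n)
    (hl1 : lam q M n = 1) (hl : lam q M (n + 1) = 0) (k r : ℕ) :
    MS q M n k (n * r + k) (w0 n k r) := by
  have H' := fwd_HR H 0
  induction r with
  | zero =>
    let e := (LinearEquiv.ofFinrankEq (R := K) (Fin (lam q (Msh q M) k) → K)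
      (LinearMap.range (cmp k (asym q (fwd (Msh q M) 0) k))) (Module.finrank_fin_fun K))
    refine ⟨inf K ι k ∘ₗ (Submodule.subtype _) ∘ₗ e.toLinearMap, ?_, fun y => ⟨?_, ?_⟩⟩
    · intro x y hxy
      have := congrArg (res K ι k) hxy
      simp only [LinearMap.comp_apply, res_inf] at this
      exact e.injective (Subtype.ext this)
    · have := inf_mem k (e y : (Fin k → ι) → K)
      simpa using this
    · obtain ⟨g, hg⟩ := (e y).2
      have h2 : (inf K ι k ∘ₗ (Submodule.subtype _) ∘ₗ e.toLinearMap) y =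
          asym q (fwd (Msh q M) 0) k (inf K ι k g) := by
        change inf K ι k (e y : (Fin k → ι) → K) = _
        rw [← hg]
        exact inf_res k _ (asym0_mem k _ (inf_mem k g))
      rw [h2]
      intro i hi
      have hi' : i < k := by simpa [w0] using hi
      rw [w0, rep_cf n k i hi']
      have h3 : ct q n (i + (n - 1)) = qn q i := by
        unfold ct
        rw [Nat.add_comm, qn_add]
        field_simp; ring
      rw [h3]
      refine JM_sym h0 _ i fun m hm => ?_
      rw [fwd_Msh]
      have := kill_asym (sharp_HR H') k (inf K ι k g) m (by omega)
      rw [sharp_apply] at this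
      have h4 : ∀ a b : (ℤ → ι) → K, (q - 1) • a - b = -a → b = q • a := fun a b h => by
        have : b = (q - 1) • a + a := by rw [sub_eq_iff_eq_add] at h; rw [h]; abel
        rw [this]; module
      exact h4 _ _ this
  | succ r ih =>
    obtain ⟨φ, hi, hφ⟩ := ih
    obtain ⟨u, hu, hu0, hk⟩ := exists_u H' hl1
    let Ψ : Module.End K ((ℤ → ι) → K) :=
      { toFun := fun y => ten n u y
        map_add' := fun a b => ten_add' n u a b
        map_smul' := fun a b => ten_smul' n u b a }
    have eN : n * (r + 1) + k = n + (n * r + k) := by ring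
    refine ⟨Ψ ∘ₗ φ, ?_, fun y => ⟨?_, ?_⟩⟩
    · rw [injective_iff_map_eq_zero]
      intro y hy
      exact hi (by rw [ten_inj hu hu0 (hφ y).1 hy, map_zero])
    · rw [eN]; exact ten_mem hu (hφ y).1
    · change JE q (fwd M 0) n _ (ten n u (φ y))
      intro i hi'
      rw [w0_length] at hi'
      rw [w0, app_cf n _ (w0_lat n k r hn) i (by rw [w0_length]; linarith)]
      split_ifs with hin
      · refine JM_kill h0 _ i (fun i => ct q n (n - 1 - i)) (by simp [ct_base]) (fun j hj => ?_)
          (fun m hm => ten_kill hk (hφ y).1 m (by omega))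
        have : n - 1 - j = n - 1 - (j + 1) + 1 := by omega
        rw [this, ct_succ h0]; ring
      · obtain ⟨j, rfl⟩ := Nat.exists_eq_add_of_le (show n ≤ i by omega)
        have hj : j < n * r + k := by omega
        rw [JM_shift h0 hq H' hl hu hk j _ (hφ y).1 hj, Nat.add_sub_cancel_left, ct_succ h0,
          (hφ y).2 j (by rw [w0_length]; exact hj), ← ten_smul']
        congr 1
        module

theorem word_bound (h0 : q ≠ 0) (hq : ∀ k, 1 ≤ k → qn q k ≠ 0) (H : MH q M) {n : ℕ} (hn : 1 ≤ n)
    (hl1 : lam q M n = 1) (hl : lam q M (n + 1) = 0) (k r : ℕ) (𝒯 : Finset (List ℕ))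
    (h𝒯 : ∀ w ∈ 𝒯, Lat n w ∧ w.Perm (w0 n k r)) :
    𝒯.card * lam q (Msh q M) k ≤ Fintype.card ι ^ (n * r + k) := by
  have H' := fwd_HR H 0
  set N := n * r + k with hN
  have h1 : ∀ w ∈ 𝒯, MS q M n k N w := by
    intro w hw
    have hc := lat_connected _ _ (w0_lat n k r hn) (h𝒯 w hw).1 (h𝒯 w hw).2.symm
    suffices ∀ w', Relation.ReflTransGen (LStep n) (w0 n k r) w' →
        MS q M n k N w' ∧ w'.length = N from (this w hc).1
    intro w' h'
    induction h' with
    | refl => exact ⟨MS_base h0 hq H hn hl1 hl k r, w0_length n k r⟩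
    | tail _ hs ih =>
      refine ⟨MS_step h0 hq H' hs ih.2 ih.1, ?_⟩
      obtain ⟨s, a, b, t, -, -, -, rfl, rfl⟩ := hs
      rw [← ih.2]; simp
  have h2 : ∀ w : 𝒯, MS q M n k N w := fun w => h1 w w.2
  choose φ hinj hφ using h2
  let Φ : (𝒯 → Fin (lam q (Msh q M) k) → K) →ₗ[K] ((Fin N → ι) → K) :=
    res K ι N ∘ₗ ∑ w : 𝒯, φ w ∘ₗ LinearMap.proj w
  have hΦ : Function.Injective Φ := by
    rw [injective_iff_map_eq_zero]
    intro x hx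
    have hs : ∑ w : 𝒯, φ w (x w) = 0 := by
      have hm : ∑ w : 𝒯, φ w (x w) ∈ Xs K ι N := Submodule.sum_mem _ fun w _ => (hφ w _).1
      rw [← inf_res N _ hm]
      have : res K ι N (∑ w : 𝒯, φ w (x w)) = 0 := by
        rw [← hx]; simp [Φ]
      rw [this, map_zero]
    have hz := joint_indep (JM q (fwd M 0)) (fun (w : 𝒯) i => ct q n (cf n w i)) N Finset.univ
      (fun w => φ w (x w)) (fun w _ i hi => (hφ w (x w)).2 i (by
        rw [(h𝒯 w w.2).2.length_eq, w0_length]; exact hi))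
      (fun w _ w' _ hne => by
        have l1 := (h𝒯 w w.2).2.length_eq
        have l2 := (h𝒯 w' w'.2).2.length_eq
        obtain ⟨i, hi, hd⟩ := cf_distinct (n := n) (w : List ℕ) w' (h𝒯 w w.2).1 (h𝒯 w' w'.2).1
          (l1.trans l2.symm) (fun h => hne (Subtype.ext h))
        rw [l1, w0_length] at hi
        exact ⟨i, hi, fun h => hd (ct_inj h0 hq n _ _ h)⟩) hs
    funext w
    exact hinj w (by rw [hz w (Finset.mem_univ _)]; simp)
  have := LinearMap.finrank_le_finrank_of_injective hΦ
  simpa [Module.finrank_pi_fintype, Module.finrank_pi] using this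

end Bound

end HeckeProof

set_option linter.unusedSectionVars false

namespace HeckeProof

section Count

/-- falling factorial determinant -/
def DD (n : ℕ) (l : Fin n → ℕ) : ℤ :=
  Matrix.det (Matrix.of fun i j : Fin n => (((l i).descFactorial (n - 1 - j) : ℕ) : ℤ))

theorem desc_pred (l j : ℕ) : (l : ℤ) * ((l - 1).descFactorial j : ℕ) =
    ((l : ℤ) - j) * (l.descFactorial j : ℕ) := by
  cases l with
  | zero =>
    cases j with
    | zero => simp
    | succ j => simp
  | succ l =>
    have h1 := Nat.succ_descFactorial_succ l j
    have h2 := Nat.descFactorial_succ (l + 1) j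
    rw [h1] at h2
    rw [Nat.add_sub_cancel]
    have h3 : (((l + 1) * l.descFactorial j : ℕ) : ℤ) = ((l + 1 - j : ℕ) : ℤ) * ((l + 1).descFactorial j : ℕ) := by
      rw [h2]; push_cast; ring
    push_cast at h3 ⊢
    rw [h3]
    rcases le_or_gt j (l + 1) with h | h
    · rw [Nat.cast_sub h]; push_cast; ring
    · rw [Nat.descFactorial_of_lt h]; simp

theorem DD_sum (n : ℕ) (l : Fin n → ℕ) :
    ∑ a, (l a : ℤ) * DD n (Function.update l a (l a - 1)) =
      (∑ a : Fin n, ((l a : ℤ) - (n - 1 - a : ℕ))) * DD n l := by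
  unfold DD
  simp only [Matrix.det_apply', Finset.mul_sum, Matrix.of_apply]
  rw [Finset.sum_comm]
  refine Finset.sum_congr rfl fun σ _ => ?_
  rw [← Equiv.sum_comp σ]
  have key : ∀ i0, (l (σ i0) : ℤ) * (((Equiv.Perm.sign σ : ℤˣ) : ℤ) *
      ∏ i, (((Function.update l (σ i0) (l (σ i0) - 1)) (σ i)).descFactorial (n - 1 - i) : ℕ)) =
      ((l (σ i0) : ℤ) - (n - 1 - i0 : ℕ)) * (((Equiv.Perm.sign σ : ℤˣ) : ℤ) *
      ∏ i, ((l (σ i)).descFactorial (n - 1 - i) : ℕ)) := by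
    intro i0
    have h1 : ∏ i ∈ Finset.univ.erase i0,
        (((Function.update l (σ i0) (l (σ i0) - 1)) (σ i)).descFactorial (n - 1 - i)) =
        ∏ i ∈ Finset.univ.erase i0, ((l (σ i)).descFactorial (n - 1 - i)) := by
      refine Finset.prod_congr rfl fun i hi => ?_
      rw [Function.update_of_ne]
      exact fun h => (Finset.mem_erase.mp hi).1 (σ.injective h)
    rw [← Finset.mul_prod_erase Finset.univ _ (Finset.mem_univ i0), h1,
      ← Finset.mul_prod_erase Finset.univ (fun i => (l (σ i)).descFactorial (n - 1 - i))
        (Finset.mem_univ i0), Function.update_self]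
    have := desc_pred (l (σ i0)) (n - 1 - i0)
    push_cast at this ⊢
    linear_combination ((Equiv.Perm.sign σ : ℤˣ) : ℤ) *
      (∏ i ∈ Finset.univ.erase i0, (((l (σ i)).descFactorial (n - 1 - i) : ℕ) : ℤ)) * this
  push_cast at key ⊢
  rw [Finset.sum_congr rfl fun i0 _ => key i0, ← Finset.sum_mul]
  congr 1
  rw [Finset.sum_sub_distrib, Finset.sum_sub_distrib, Equiv.sum_comp σ (fun i => (l i : ℤ))]

theorem DD_eq_zero (n : ℕ) (l : Fin n → ℕ) (i j : Fin n) (hij : i ≠ j) (h : l i = l j) :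
    DD n l = 0 :=
  Matrix.det_zero_of_row_eq hij (by funext k; simp [h])

theorem DD_base (n : ℕ) : DD n (fun i => n - 1 - i) = ∏ i : Fin n, ((n - 1 - i : ℕ).factorial : ℤ) := by
  unfold DD
  rw [Matrix.det_of_upperTriangular]
  · simp [Nat.descFactorial_self]
  · intro i j hij
    simp only [Matrix.of_apply]
    have h : (j : ℕ) < i := hij
    rw [Nat.descFactorial_of_lt (by omega)]; rfl

/-- removable row -/
def Rem {n : ℕ} (ν : Fin n → ℕ) (a : Fin n) : Prop := 0 < ν a ∧ ∀ s, a < s → ν s < ν a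

open Classical in
/-- finset of lattice words of given shape -/
noncomputable def LW (n : ℕ) : ℕ → (Fin n → ℕ) → Finset (List ℕ)
  | 0, _ => {[]}
  | N + 1, ν => (Finset.univ.filter (Rem ν)).biUnion fun a =>
      (LW n N (Function.update ν a (ν a - 1))).image (List.cons (a : ℕ))

theorem anti_update {n : ℕ} {ν : Fin n → ℕ} (h : Antitone ν) {a : Fin n} (ha : Rem ν a) :
    Antitone (Function.update ν a (ν a - 1)) := by
  intro i j hij
  by_cases hi : i = a
  · subst hi
    by_cases hj : j = i
    · subst hj; exact le_rfl
    · rw [Function.update_self, Function.update_of_ne hj]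
      have := ha.2 j (lt_of_le_of_ne hij (Ne.symm hj)); omega
  · rw [Function.update_of_ne hi]
    by_cases hj : j = a
    · subst hj; rw [Function.update_self]; have := h hij; omega
    · rw [Function.update_of_ne hj]; exact h hij

theorem sum_update {n : ℕ} {ν : Fin n → ℕ} {a : Fin n} (ha : 0 < ν a) :
    ∑ i, ν i = ∑ i, Function.update ν a (ν a - 1) i + 1 := by
  rw [Finset.sum_update_of_mem (Finset.mem_univ a), ← Finset.add_sum_erase _ _ (Finset.mem_univ a),
    Finset.sdiff_singleton_eq_erase]
  omega

theorem LW_spec {n : ℕ} (N : ℕ) : ∀ ν : Fin n → ℕ, Antitone ν → ∑ i, ν i = N → ∀ w ∈ LW n N ν,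
    Lat n w ∧ ∀ a : Fin n, w.count (a : ℕ) = ν a := by
  classical
  induction N with
  | zero =>
    intro ν _ hs w hw
    simp only [LW, Finset.mem_singleton] at hw
    subst hw
    refine ⟨trivial, fun a => ?_⟩
    have := (Finset.sum_eq_zero_iff.mp hs) a (Finset.mem_univ a)
    simp [this]
  | succ N ih =>
    intro ν hν hs w hw
    simp only [LW, Finset.mem_biUnion, Finset.mem_filter, Finset.mem_univ, true_and,
      Finset.mem_image] at hw
    obtain ⟨a, ha, t, ht, rfl⟩ := hw
    have h1 := sum_update ha.1
    obtain ⟨hl, hc⟩ := ih _ (anti_update hν ha) (by omega) t ht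
    refine ⟨⟨hl, a.2, fun r hr => ?_⟩, fun b => ?_⟩
    · have e1 := hc a
      have e2 := hc ⟨r, by omega⟩
      rw [Function.update_self] at e1
      rw [Function.update_of_ne (by intro h; rw [Fin.ext_iff] at h; simp at h; omega)] at e2
      simp only [] at e2
      have := hν (show (⟨r, by omega⟩ : Fin n) ≤ a from le_of_lt hr)
      have := ha.1
      omega
    · have e := hc b
      by_cases hb : b = a
      · subst hb
        rw [Function.update_self] at e
        rw [List.count_cons_self, e]; have := ha.1; omega
      · rw [Function.update_of_ne hb] at e
        rw [List.count_cons_of_ne (fun h => hb (Fin.ext h.symm)), e]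

theorem LW_mem {n : ℕ} (w : List ℕ) (h : Lat n w) :
    w ∈ LW n w.length (fun a : Fin n => w.count (a : ℕ)) := by
  classical
  induction w with
  | nil => simp [LW]
  | cons a t ih =>
    simp only [List.length_cons, LW, Finset.mem_biUnion, Finset.mem_filter, Finset.mem_univ,
      true_and, Finset.mem_image]
    refine ⟨⟨a, h.2.1⟩, ⟨by simp, fun s hs => ?_⟩, t, ?_, rfl⟩
    · have hs' : a < s := hs
      have := lat_mono h.1 a s hs'
      simp only [List.count_cons_self]
      rw [List.count_cons_of_ne (by omega)]; omega
    · convert ih h.1 using 2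
      funext b
      by_cases hb : b = ⟨a, h.2.1⟩
      · subst hb; simp
      · rw [Function.update_of_ne hb, List.count_cons_of_ne]
        intro h'; exact hb (Fin.ext h'.symm)

theorem LW_card {n : ℕ} (N : ℕ) : ∀ ν : Fin n → ℕ, Antitone ν → ∑ i, ν i = N →
    ((LW n N ν).card : ℤ) * ∏ i : Fin n, ((ν i + (n - 1 - i)).factorial : ℤ) =
      (N.factorial : ℤ) * DD n (fun i => ν i + (n - 1 - i)) := by
  classical
  induction N with
  | zero =>
    intro ν _ hs
    have h0 : ν = fun _ => 0 := funext fun a => (Finset.sum_eq_zero_iff.mp hs) a (Finset.mem_univ a)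
    subst h0
    simp only [LW, Nat.zero_add]
    rw [DD_base]; simp
  | succ N ih =>
    intro ν hν hs
    set l : Fin n → ℕ := fun i => ν i + (n - 1 - i) with hl
    have hlu : ∀ a, 0 < ν a → (fun i : Fin n => Function.update ν a (ν a - 1) i + (n - 1 - i)) =
        Function.update l a (l a - 1) := by
      intro a ha
      funext i
      by_cases hi : i = a
      · subst hi; simp only [Function.update_self, hl]; omega
      · simp only [Function.update_of_ne hi, hl]
    have hcard : (LW n (N + 1) ν).card =
        ∑ a ∈ Finset.univ.filter (Rem ν), (LW n N (Function.update ν a (ν a - 1))).card := by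
      simp only [LW]
      rw [Finset.card_biUnion]
      · refine Finset.sum_congr rfl fun a _ => Finset.card_image_of_injective _ ?_
        intro x y hxy; exact (List.cons.inj hxy).2
      · intro a _ b _ hab
        rw [Function.onFun, Finset.disjoint_left]
        intro w hw hw'
        rw [Finset.mem_image] at hw hw'
        obtain ⟨t, _, rfl⟩ := hw
        obtain ⟨t', _, h'⟩ := hw'
        exact hab (Fin.ext (List.cons.inj h').1.symm)
    have hsum := DD_sum n l
    have hS : ∑ a : Fin n, ((l a : ℤ) - (n - 1 - a : ℕ)) = (N + 1 : ℕ) := by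
      rw [← hs]; push_cast
      refine Finset.sum_congr rfl fun a _ => ?_
      simp only [hl]; push_cast; ring
    rw [hS] at hsum
    have hterm : ∀ a, Rem ν a → ((LW n N (Function.update ν a (ν a - 1))).card : ℤ) *
        ∏ i : Fin n, ((l i).factorial : ℤ) =
        (N.factorial : ℤ) * ((l a : ℤ) * DD n (Function.update l a (l a - 1))) := by
      intro a ha
      have h1 := sum_update ha.1
      have h2 := ih _ (anti_update hν ha) (by omega)
      have h3 := hlu a ha.1
      rw [h3] at h2
      have h4 : ∀ i : Fin n, Function.update ν a (ν a - 1) i + (n - 1 - i) =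
        Function.update l a (l a - 1) i := fun i => congrFun h3 i
      simp only [h4] at h2
      have h5 : ∏ i : Fin n, ((l i).factorial : ℤ) =
          l a * ∏ i : Fin n, ((Function.update l a (l a - 1) i).factorial : ℤ) := by
        rw [← Finset.mul_prod_erase _ _ (Finset.mem_univ a),
          ← Finset.mul_prod_erase _ (fun i => ((Function.update l a (l a - 1) i).factorial : ℤ))
            (Finset.mem_univ a), Function.update_self, ← mul_assoc]
        have hpos : 0 < l a := by have := ha.1; simp only [hl]; omega
        congr 1
        · have := Nat.mul_factorial_pred (show l a ≠ 0 by omega)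
          rw [← this]; push_cast; rfl
        · refine Finset.prod_congr rfl fun i hi => ?_
          rw [Function.update_of_ne (Finset.mem_erase.mp hi).1]
      rw [h5]
      linear_combination (l a : ℤ) * h2
    have hzero : ∀ a, ¬ Rem ν a → (l a : ℤ) * DD n (Function.update l a (l a - 1)) = 0 := by
      intro a ha
      by_cases hlast : (a : ℕ) + 1 < n
      · let b : Fin n := ⟨a + 1, hlast⟩
        have hab : a < b := by simp [b, Fin.lt_def]
        have hle := hν hab.le
        have heq : ν b = ν a := by
          by_contra hne
          refine ha ⟨by omega, fun s hs => ?_⟩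
          have : b ≤ s := by simp only [b, Fin.le_def]; exact hs
          have := hν this
          omega
        rw [DD_eq_zero n _ a b hab.ne, mul_zero]
        rw [Function.update_self, Function.update_of_ne hab.ne']
        simp only [hl, heq, b]; omega
      · have h0 : ν a = 0 := by
          by_contra hne
          refine ha ⟨by omega, fun s hs => ?_⟩
          have : (a : ℕ) < s := hs
          have := s.2; omega
        have : l a = 0 := by simp only [hl, h0]; omega
        rw [this]; simp
    rw [hcard, Nat.factorial_succ]
    push_cast at hsum ⊢
    rw [Finset.sum_mul, Finset.sum_congr rfl fun a ha => hterm a (Finset.mem_filter.mp ha).2,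
      ← Finset.mul_sum, Finset.sum_filter_of_ne (fun a _ h => by
        by_contra hc; exact h (hzero a hc)), hsum]
    ring

theorem LW_bound {n : ℕ} (w : List ℕ) (h : Lat n w) (hs : ∑ a : Fin n, w.count (a : ℕ) = w.length) :
    w.length.factorial ≤ (LW n w.length (fun a : Fin n => w.count (a : ℕ))).card *
      ∏ i : Fin n, (w.count (i : ℕ) + (n - 1 - i)).factorial := by
  have ha : Antitone (fun a : Fin n => w.count (a : ℕ)) := by
    intro i j hij
    rcases eq_or_lt_of_le hij with rfl | hlt
    · exact le_rfl
    · exact lat_mono h i j hlt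
  have h1 := LW_card w.length (fun a : Fin n => w.count (a : ℕ)) ha hs
  have hpos : 0 < (LW n w.length (fun a : Fin n => w.count (a : ℕ))).card :=
    Finset.card_pos.mpr ⟨w, LW_mem w h⟩
  set D := DD n (fun i => w.count (i : ℕ) + (n - 1 - i))
  have hpos2 : (0 : ℤ) < ∏ i : Fin n, ((w.count (i : ℕ) + (n - 1 - i)).factorial : ℤ) :=
    Finset.prod_pos fun i _ => by exact_mod_cast Nat.factorial_pos _
  have hD : 1 ≤ D := by
    have h3 : 0 < (w.length.factorial : ℤ) * D := by
      rw [← h1]; exact mul_pos (by exact_mod_cast hpos) hpos2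
    have := (pos_iff_pos_of_mul_pos h3).mp (by positivity)
    omega
  have h4 : (w.length.factorial : ℤ) ≤ (w.length.factorial : ℤ) * D :=
    le_mul_of_one_le_right (by positivity) hD
  rw [← h1] at h4
  exact_mod_cast h4

end Count

end HeckeProof

set_option linter.unusedSectionVars false

namespace HeckeProof

section Estimate

theorem est1 (n r : ℕ) (hr : 1 ≤ r) :
    n ^ (n * r) * r.factorial ^ n ≤ (n * r) ^ n * (n * r).factorial := by
  induction r, hr using Nat.le_induction with
  | base => simpa using Nat.le_mul_of_pos_right (n ^ n) (Nat.factorial_pos n)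
  | succ r hr ih =>
    have h1 : (n * r).factorial * (n * r) ^ n ≤ (n * r + n).factorial :=
      le_trans (Nat.mul_le_mul_left _ (Nat.pow_le_pow_left (by omega) n))
        (Nat.factorial_mul_pow_le_factorial (m := n * r) (n := n))
    calc n ^ (n * (r + 1)) * (r + 1).factorial ^ n
        = (n ^ (n * r) * r.factorial ^ n) * (n * (r + 1)) ^ n := by
          rw [Nat.factorial_succ, mul_pow, mul_pow n (r + 1) n, Nat.mul_succ, pow_add]
          have aux : ∀ a b c d : ℕ, a * b * (d * c) = a * c * (b * d) := by intros; ring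
          exact aux _ _ _ _
      _ ≤ ((n * r) ^ n * (n * r).factorial) * (n * (r + 1)) ^ n := Nat.mul_le_mul_right _ ih
      _ = (n * (r + 1)) ^ n * ((n * r).factorial * (n * r) ^ n) := by ring
      _ ≤ (n * (r + 1)) ^ n * (n * (r + 1)).factorial := by
          rw [Nat.mul_succ]; exact Nat.mul_le_mul_left _ h1

theorem est2 (k : ℕ) (hk : 1 ≤ k) : (k + 1) ^ k ≤ 3 * k ^ k := by
  have hk' : (0 : ℝ) < k := by exact_mod_cast hk
  have h1 : (1 + 1 / (k : ℝ)) ^ k ≤ 3 := by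
    calc (1 + 1 / (k : ℝ)) ^ k ≤ (Real.exp (1 / k)) ^ k := by
          refine pow_le_pow_left₀ (by positivity) ?_ k
          rw [add_comm]; exact Real.add_one_le_exp _
      _ = Real.exp 1 := by rw [← Real.exp_nat_mul]; congr 1; field_simp
      _ ≤ 3 := by have := Real.exp_one_lt_d9; linarith
  have h2 : ((k : ℝ) + 1) ^ k = (1 + 1 / (k : ℝ)) ^ k * (k : ℝ) ^ k := by
    rw [← mul_pow]; congr 1; field_simp
  have h3 : ((k : ℝ) + 1) ^ k ≤ 3 * (k : ℝ) ^ k := by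
    rw [h2]; exact mul_le_mul_of_nonneg_right h1 (by positivity)
  exact_mod_cast h3

theorem fact_add_le (m d B : ℕ) (h : m + d ≤ B) : (m + d).factorial ≤ m.factorial * B ^ d := by
  rw [← Nat.factorial_mul_ascFactorial]
  refine Nat.mul_le_mul_left _ ((Nat.ascFactorial_le_pow_add m d).trans (Nat.pow_le_pow_left h d))

theorem est3 (n k : ℕ) (hk : 1 ≤ k) (hn : 1 ≤ n) :
    n ^ (n * k ^ 2 + k) * ((k ^ 2 + k).factorial * (k ^ 2).factorial ^ (n - 1)) ≤
      3 * (n * k ^ 2) ^ n * (n * k ^ 2 + k).factorial := by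
  obtain ⟨m, rfl⟩ : ∃ m, n = m + 1 := ⟨n - 1, by omega⟩
  set n := m + 1 with hnm
  set r := k ^ 2 with hr
  have hr1 : 1 ≤ r := Nat.one_le_pow _ _ hk
  have h1 := est1 n r hr1
  have h2 := est2 k hk
  have h3 := fact_add_le r k (r + k) le_rfl
  have h4 : (n * r).factorial * (n * r) ^ k ≤ (n * r + k).factorial :=
      le_trans (Nat.mul_le_mul_left _ (Nat.pow_le_pow_left (by omega) k))
        (Nat.factorial_mul_pow_le_factorial (m := n * r) (n := k))
  have h5 : (n * (r + k)) ^ k ≤ 3 * (n * r) ^ k := by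
    have e1 : (n * (r + k)) ^ k = (n * k) ^ k * (k + 1) ^ k := by rw [← mul_pow, hr]; congr 1; ring
    have e2 : (n * r) ^ k = (n * k) ^ k * k ^ k := by rw [← mul_pow, hr]; congr 1; ring
    rw [e1, e2]
    calc _ ≤ (n * k) ^ k * (3 * k ^ k) := Nat.mul_le_mul_left _ h2
      _ = _ := by ring
  have e : n - 1 = m := by omega
  rw [e]
  calc n ^ (n * r + k) * ((r + k).factorial * r.factorial ^ m)
      ≤ n ^ (n * r + k) * ((r.factorial * (r + k) ^ k) * r.factorial ^ m) := by gcongr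
    _ = (n ^ (n * r) * r.factorial ^ (m + 1)) * (n * (r + k)) ^ k := by
        rw [mul_pow n (r + k) k, pow_add, pow_succ]
        have aux : ∀ a b c d e : ℕ, a * b * (c * d * e) = a * (e * c) * (b * d) := by intros; ring
        exact aux _ _ _ _ _
    _ ≤ ((n * r) ^ n * (n * r).factorial) * (3 * (n * r) ^ k) := Nat.mul_le_mul h1 h5
    _ = 3 * (n * r) ^ n * ((n * r).factorial * (n * r) ^ k) := by ring
    _ ≤ _ := Nat.mul_le_mul_left _ h4

theorem prod_shape (n k r : ℕ) (hn : 1 ≤ n) :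
    ∏ i : Fin n, ((w0 n k r).count (i : ℕ) + (n - 1 - i)).factorial ≤
      ((r + k).factorial * r.factorial ^ (n - 1)) * ((r + k + n) ^ n) ^ n := by
  obtain ⟨m, rfl⟩ : ∃ m, n = m + 1 := ⟨n - 1, by omega⟩
  have h1 : ∀ i : Fin (m + 1), ((w0 (m + 1) k r).count (i : ℕ) + (m + 1 - 1 - i)).factorial ≤
      ((w0 (m + 1) k r).count (i : ℕ)).factorial * (r + k + (m + 1)) ^ (m + 1) := fun i => by
    refine (fact_add_le _ _ (r + k + (m + 1)) ?_).trans
      (Nat.mul_le_mul_left _ (Nat.pow_le_pow_right (by omega) (by omega)))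
    rw [w0_count]; split_ifs <;> omega
  refine (Finset.prod_le_prod' fun i _ => h1 i).trans ?_
  rw [Finset.prod_mul_distrib, Finset.prod_const, Finset.card_univ, Fintype.card_fin]
  refine Nat.mul_le_mul_right _ (le_of_eq ?_)
  rw [Fin.prod_univ_succ]
  simp [w0_count]

end Estimate

section Poly
variable {K : Type*} [Field K] {ι : Type*} [Fintype ι] [DecidableEq ι] [Inhabited ι]
variable {q : K} {M : ι → ι → ι → ι → K}

theorem s_bound (h0 : q ≠ 0) (hq : ∀ k, 1 ≤ k → qn q k ≠ 0) (H : MH q M) {n : ℕ} (hn : 1 ≤ n)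
    (hι : Fintype.card ι = n)
    (hl1 : lam q M n = 1) (hl : lam q M (n + 1) = 0) (k : ℕ) (hk : 1 ≤ k) :
    lam q (Msh q M) k ≤ (3 * n ^ n * ((n + 1) ^ n) ^ n) * (k + 1) ^ (2 * n + 2 * (n * n)) := by
  set r := k ^ 2 with hr
  set w := w0 n k r with hw
  have hwl : w.length = n * r + k := w0_length n k r
  have hlat : Lat n w := w0_lat n k r hn
  have hsum : ∑ a : Fin n, w.count (a : ℕ) = w.length := by
    rw [hwl]
    simp only [hw, w0_count]
    rw [Finset.sum_add_distrib]
    obtain ⟨m, rfl⟩ : ∃ m, n = m + 1 := ⟨n - 1, by omega⟩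
    congr 1
    · rw [Finset.sum_congr rfl (fun i _ => if_pos i.2)]; simp
    · rw [Fin.sum_univ_succ]; simp
  have hanti : Antitone (fun a : Fin n => w.count (a : ℕ)) := by
    intro i j hij
    rcases eq_or_lt_of_le hij with rfl | hlt
    · exact le_rfl
    · exact lat_mono hlat i j hlt
  have hc := LW_bound w hlat hsum
  have hb := word_bound h0 hq H hn hl1 hl k r (LW n w.length (fun a : Fin n => w.count (a : ℕ)))
    (fun v hv => by
      obtain ⟨h1, h2⟩ := LW_spec w.length _ hanti hsum v hv
      refine ⟨h1, List.perm_iff_count.mpr fun a => ?_⟩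
      by_cases ha : a < n
      · exact h2 ⟨a, ha⟩
      · rw [List.count_eq_zero_of_not_mem fun h => ha (lat_lt h1 a h),
          List.count_eq_zero_of_not_mem fun h => ha (lat_lt hlat a h)])
  have hp := prod_shape n k r hn
  have he := est3 n k hk hn
  rw [hwl] at hc
  rw [hι] at hb
  set c := (LW n w.length (fun a : Fin n => w.count (a : ℕ))).card with hcdef
  rw [← hwl, ← hcdef, hwl] at hc
  set P := ∏ i : Fin n, (w.count (i : ℕ) + (n - 1 - i)).factorial
  set s := lam q (Msh q M) k
  have hfin : (n * r + k).factorial * s ≤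
      (n * r + k).factorial * (3 * (n * r) ^ n * ((r + k + n) ^ n) ^ n) := by
    calc (n * r + k).factorial * s ≤ (c * P) * s := Nat.mul_le_mul_right _ hc
      _ = (c * s) * P := by ring
      _ ≤ n ^ (n * r + k) * (((r + k).factorial * r.factorial ^ (n - 1)) * ((r + k + n) ^ n) ^ n) :=
          Nat.mul_le_mul hb hp
      _ = (n ^ (n * r + k) * ((r + k).factorial * r.factorial ^ (n - 1))) * ((r + k + n) ^ n) ^ n := by
          ring
      _ ≤ (3 * (n * r) ^ n * (n * r + k).factorial) * ((r + k + n) ^ n) ^ n :=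
          Nat.mul_le_mul_right _ he
      _ = _ := by ring
  have hs := Nat.le_of_mul_le_mul_left hfin (Nat.factorial_pos _)
  have e1 : n * r ≤ n * (k + 1) ^ 2 := Nat.mul_le_mul_left _ (Nat.pow_le_pow_left (by omega) 2)
  have e2 : r + k + n ≤ (n + 1) * (k + 1) ^ 2 := by rw [hr]; nlinarith
  calc s ≤ _ := hs
    _ ≤ 3 * (n * (k + 1) ^ 2) ^ n * (((n + 1) * (k + 1) ^ 2) ^ n) ^ n := by gcongr
    _ = _ := by
      simp only [mul_pow, ← pow_mul, pow_add]
      ring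

end Poly

end HeckeProof

set_option linter.unusedSectionVars false

namespace HeckeProof

section Comb
open Polynomial

theorem no_big_root {n : ℕ} {l s : ℕ → ℕ} (hl0 : l 0 = 1) (hln : ∀ k, n < k → l k = 0)
    (hs0 : s 0 = 1)
    (hk : ∀ k, ∑ j ∈ Finset.range (k + 2), (-1 : ℤ) ^ j * (l j * s (k + 1 - j)) = 0)
    {C D : ℕ} (hb : ∀ k, 1 ≤ k → s k ≤ C * (k + 1) ^ D) (t : ℂ) (ht : ‖t‖ < 1) :
    ∑ j ∈ Finset.range (n + 1), (-1 : ℂ) ^ j * l j * t ^ j ≠ 0 := by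
  have hf0 : ∀ j ∉ Finset.range (n + 1), (-1 : ℂ) ^ j * l j * t ^ j = 0 := fun j hj => by
    rw [hln j (by simpa using hj)]; simp
  have hf : Summable fun j => ‖(-1 : ℂ) ^ j * l j * t ^ j‖ :=
    summable_of_ne_finset_zero (s := Finset.range (n + 1)) fun j hj => by rw [hf0 j hj, norm_zero]
  have hg : Summable fun k => ‖(s k : ℂ) * t ^ k‖ := by
    refine (summable_nat_add_iff 1).mp ?_
    refine Summable.of_nonneg_of_le (fun _ => norm_nonneg _) (fun k => ?_)
      (((summable_nat_add_iff 1).mpr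
        (summable_norm_pow_mul_geometric_of_norm_lt_one D ht)).mul_left ((C : ℝ) * 2 ^ D))
    have h1 := hb (k + 1) (by omega)
    have h2 : s (k + 1) ≤ C * 2 ^ D * (k + 1) ^ D := by
      refine h1.trans ?_
      rw [mul_assoc, ← mul_pow]
      exact Nat.mul_le_mul_left _ (Nat.pow_le_pow_left (by omega) D)
    have h3 : (s (k + 1) : ℝ) ≤ C * 2 ^ D * ((k + 1 : ℕ) : ℝ) ^ D := by exact_mod_cast h2
    rw [norm_mul, norm_mul, norm_pow ((k + 1 : ℕ) : ℂ), Complex.norm_natCast, Complex.norm_natCast,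
      ← mul_assoc]
    exact mul_le_mul_of_nonneg_right h3 (norm_nonneg _)
  have hp := tsum_mul_tsum_eq_tsum_sum_range_of_summable_norm hf hg
  have hr : ∀ m, ∑ k ∈ Finset.range (m + 1), (-1 : ℂ) ^ k * l k * t ^ k * (s (m - k) * t ^ (m - k)) =
      if m = 0 then 1 else 0 := by
    intro m
    rcases m with _ | m
    · simp [hl0, hs0]
    · have h1 : ((∑ j ∈ Finset.range (m + 2), (-1 : ℤ) ^ j * (l j * s (m + 1 - j)) : ℤ) : ℂ) = 0 := by
        rw [hk m]; simp
      push_cast at h1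
      rw [if_neg (by omega), ← zero_mul (t ^ (m + 1)), ← h1, Finset.sum_mul]
      refine Finset.sum_congr rfl fun j hj => ?_
      have e : t ^ (m + 1) = t ^ j * t ^ (m + 1 - j) := by
        rw [← pow_add]; congr 1; have := Finset.mem_range.mp hj; omega
      rw [e]; ring
  simp only [hr] at hp
  rw [tsum_eq_sum hf0, tsum_ite_eq] at hp
  intro h
  rw [h, zero_mul] at hp
  exact zero_ne_one hp

theorem comb_lam {n : ℕ} (hn : 1 ≤ n) {l s : ℕ → ℕ} (hl0 : l 0 = 1) (hl1 : l 1 = n)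
    (hln : ∀ k, n < k → l k = 0) (hs0 : s 0 = 1)
    (hk : ∀ k, ∑ j ∈ Finset.range (k + 2), (-1 : ℤ) ^ j * (l j * s (k + 1 - j)) = 0)
    {C D : ℕ} (hb : ∀ k, 1 ≤ k → s k ≤ C * (k + 1) ^ D) (k : ℕ) : l k = n.choose k := by
  let c : ℕ → ℂ := fun j => (-1 : ℂ) ^ j * l j
  let Q : ℂ[X] := ∑ i ∈ Finset.range (n + 1), Polynomial.C (c (n - i)) * X ^ i
  have hQc : ∀ i, Q.coeff i = if i < n + 1 then c (n - i) else 0 := fun i => by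
    simp only [Q, finset_sum_coeff, coeff_C_mul, coeff_X_pow, mul_ite, mul_one, mul_zero]
    rw [Finset.sum_ite_eq]; simp only [Finset.mem_range]
  have hcn : Q.coeff n = 1 := by rw [hQc]; simp [c, hl0]
  have hdeg : Q.natDegree = n := by
    refine le_antisymm ?_ (le_natDegree_of_ne_zero (by rw [hcn]; exact one_ne_zero))
    refine natDegree_le_iff_coeff_eq_zero.mpr fun i hi => ?_
    rw [hQc, if_neg (by omega)]
  have hmon : Q.Monic := by rw [Monic, leadingCoeff, hdeg, hcn]
  have hspl := IsAlgClosed.splits Q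
  have hnext : Q.nextCoeff = -(n : ℂ) := by
    rw [nextCoeff_of_natDegree_pos (by omega), hdeg, hQc, if_pos (by omega),
      show n - (n - 1) = 1 by omega]
    simp [c, hl1]
  have hsum : Q.roots.sum = n := by
    have := hspl.nextCoeff_eq_neg_sum_roots_of_monic hmon
    rw [hnext] at this
    exact (neg_injective this).symm
  have hcard : Q.roots.card = n := by rw [← hspl.natDegree_eq_card_roots, hdeg]
  have hnorm : ∀ a ∈ Q.roots, ‖a‖ ≤ 1 := by
    intro a ha
    by_contra hlt
    push Not at hlt
    have ha0 : a ≠ 0 := by rintro rfl; simp at hlt; linarith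
    have hev : Q.eval a = 0 := (mem_roots'.mp ha).2
    refine no_big_root hl0 hln hs0 hk hb a⁻¹ (by rw [norm_inv]; exact inv_lt_one_of_one_lt₀ hlt) ?_
    have : ∑ j ∈ Finset.range (n + 1), (-1 : ℂ) ^ j * l j * a⁻¹ ^ j = Q.eval a * a⁻¹ ^ n := by
      rw [← Finset.sum_range_reflect]
      simp only [Q, eval_finset_sum, Finset.sum_mul]
      refine Finset.sum_congr rfl fun i hi => ?_
      have hi' : i ≤ n := by have := Finset.mem_range.mp hi; omega
      rw [show n + 1 - 1 - i = n - i by omega]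
      have e : a⁻¹ ^ n = a⁻¹ ^ i * a⁻¹ ^ (n - i) := by rw [← pow_add]; congr 1; omega
      have e2 : a ^ i * a⁻¹ ^ i = 1 := by rw [← mul_pow, mul_inv_cancel₀ ha0, one_pow]
      simp only [eval_mul, eval_C, eval_pow, eval_X, c]
      rw [e]
      linear_combination (-((-1 : ℂ) ^ (n - i) * l (n - i) * a⁻¹ ^ (n - i))) * e2
    rw [this, hev, zero_mul]
  have hre : ∀ a ∈ Q.roots, a.re ≤ 1 := fun a ha =>
    (Complex.re_le_norm a).trans (hnorm a ha)
  have hone : ∀ a ∈ Q.roots, a = 1 := by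
    have h1 : (Q.roots.map fun a => 1 - a.re).sum = 0 := by
      rw [Multiset.sum_map_sub]
      have : (Q.roots.map fun a => a.re).sum = Q.roots.sum.re :=
        (map_multiset_sum Complex.reAddGroupHom Q.roots).symm
      rw [this, hsum]
      simp [hcard]
    have h2 := Multiset.single_le_sum (s := Q.roots.map fun a => 1 - a.re) (by
      intro x hx
      obtain ⟨a, ha, rfl⟩ := Multiset.mem_map.mp hx
      have := hre a ha; linarith)
    rw [h1] at h2
    intro a ha
    have h3 : a.re = 1 := by
      have := h2 _ (Multiset.mem_map_of_mem _ ha); have := hre a ha; linarith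
    have h4 := hnorm a ha
    have h5 : a.re * a.re + a.im * a.im ≤ 1 := by
      have := Complex.normSq_eq_norm_sq a
      rw [Complex.normSq_apply] at this
      rw [this]; nlinarith [norm_nonneg a]
    have h6 : a.im = 0 := by rw [h3] at h5; nlinarith [mul_self_nonneg a.im]
    exact Complex.ext (by simpa using h3) (by simpa using h6)
  have hQ : Q = (X + Polynomial.C (-1)) ^ n := by
    rw [hspl.eq_prod_roots_of_monic hmon, Multiset.eq_replicate.mpr ⟨hcard, hone⟩]
    simp [sub_eq_add_neg]
  by_cases hkn : k ≤ n
  · have h1 := hQc (n - k)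
    rw [hQ, coeff_X_add_C_pow, if_pos (by omega), show n - (n - k) = k by omega,
      Nat.choose_symm hkn] at h1
    have h2 : (-1 : ℂ) ^ k ≠ 0 := pow_ne_zero _ (by simp)
    exact_mod_cast (mul_left_cancel₀ h2 h1).symm
  · rw [hln k (by omega), Nat.choose_eq_zero_of_lt (by omega)]

theorem comb_s {n : ℕ} (hn : 1 ≤ n) {l s : ℕ → ℕ} (hl : ∀ k, l k = n.choose k) (hs0 : s 0 = 1)
    (hk : ∀ k, ∑ j ∈ Finset.range (k + 2), (-1 : ℤ) ^ j * (l j * s (k + 1 - j)) = 0) (k : ℕ) :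
    s k = (n + k - 1).choose k := by
  have hP : (1 - PowerSeries.X : PowerSeries ℤ) ^ n =
      PowerSeries.mk fun j => (-1 : ℤ) ^ j * l j := by
    have h1 : (1 - PowerSeries.X : PowerSeries ℤ) ^ n =
        (((1 - X : ℤ[X]) ^ n : ℤ[X]) : PowerSeries ℤ) := by simp
    have h2 : (1 - X : ℤ[X]) ^ n = Polynomial.C ((-1) ^ n) * (X + Polynomial.C (-1)) ^ n := by
      rw [map_pow, ← mul_pow]; congr 1; simp [sub_eq_add_neg]
    ext j
    rw [h1, h2, Polynomial.coeff_coe, coeff_C_mul, coeff_X_add_C_pow, PowerSeries.coeff_mk, hl]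
    by_cases hj : j ≤ n
    · rw [← mul_assoc, ← pow_add, show n + (n - j) = j + 2 * (n - j) by omega, pow_add, pow_mul]
      simp
    · rw [Nat.choose_eq_zero_of_lt (by omega)]; simp
  have hmul : (1 - PowerSeries.X : PowerSeries ℤ) ^ n * PowerSeries.mk (fun k => (s k : ℤ)) = 1 := by
    ext m
    rw [hP, PowerSeries.coeff_mul,
      Finset.Nat.sum_antidiagonal_eq_sum_range_succ_mk, PowerSeries.coeff_one]
    simp only [PowerSeries.coeff_mk]
    rcases m with _ | m
    · simp [hl, hs0]
    · rw [if_neg (by omega), ← hk m]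
      exact Finset.sum_congr rfl fun j _ => by ring
  have hinv := PowerSeries.invOneSubPow_inv_eq_one_sub_pow ℤ n
  have h3 : PowerSeries.mk (fun k => (s k : ℤ)) = (PowerSeries.invOneSubPow ℤ n).val := by
    rw [← hinv] at hmul
    calc _ = (PowerSeries.invOneSubPow ℤ n).val * ((PowerSeries.invOneSubPow ℤ n).inv *
          PowerSeries.mk (fun k => (s k : ℤ))) := by
            rw [← mul_assoc, (PowerSeries.invOneSubPow ℤ n).val_inv, one_mul]
      _ = _ := by rw [hmul, mul_one]
  rw [PowerSeries.invOneSubPow_val_eq_mk_sub_one_add_choose_of_pos ℤ n hn] at h3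
  have h4 := congrArg (PowerSeries.coeff k) h3
  simp only [PowerSeries.coeff_mk] at h4
  have h5 : s k = (n - 1 + k).choose (n - 1) := by exact_mod_cast h4
  rw [h5, show n + k - 1 = n - 1 + k by omega]
  exact Nat.choose_symm_add

end Comb

section Final
variable {K : Type*} [Field K] {ι : Type*} [Fintype ι] [DecidableEq ι] [Inhabited ι]
variable {q : K} {M : ι → ι → ι → ι → K}

theorem lam_zero (M : ι → ι → ι → ι → K) : lam q M 0 = 1 := by
  have h : cmp 0 (asym q (fwd M 0) 0) = LinearMap.id := by
    refine LinearMap.ext fun g => ?_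
    exact res_inf 0 g
  rw [lam, h, LinearMap.range_id, finrank_top]; simp

theorem lam_one (M : ι → ι → ι → ι → K) : lam q M 1 = Fintype.card ι := by
  have h : cmp 1 (asym q (fwd M 0) 1) = LinearMap.id := by
    refine LinearMap.ext fun g => ?_
    simp only [cmp, LinearMap.comp_apply]
    rw [asym_one_apply]
    exact res_inf 1 g
  rw [lam, h, LinearMap.range_id, finrank_top]; simp

end Final

theorem main_pos (K : Type*) [Field K] [CharZero K] (V : Type*) [AddCommGroup V] [Module K V]
    [FiniteDimensional K V] (q : K) (hq : q ≠ 0)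
    (R : V ⊗[K] V →ₗ[K] V ⊗[K] V) (hR : IsHecke K V q R)
    (hqint : ∀ k : ℕ, 1 ≤ k → (∑ i ∈ Finset.range k, q ^ i) ≠ 0)
    (n : ℕ) (hn1 : 1 ≤ n) (hn : n = Module.finrank K V)
    (hr : lambdaDim K V R n = 1) (hr' : ∀ k, n < k → lambdaDim K V R k = 0) :
    (∀ k, lambdaDim K V R k = n.choose k) ∧
      (∀ k, sDim K V q R k = (n + k - 1).choose k) := by
  haveI : Inhabited (Fin n) := ⟨⟨0, hn1⟩⟩
  let b := Module.finBasisOfFinrankEq K V hn.symm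
  have hrep := exists_rep b R
  generalize (fun x y c d => (b.tensorProduct b).repr (R (b c ⊗ₜ b d)) (x, y)) = M at hrep
  have hqi : ∀ k, 1 ≤ k → qn q k ≠ 0 := hqint
  have H : MH q M := toMH_of_isHecke hrep hR
  have hL := lambdaDim_eq hqi (fwd_HR H 0) hrep
  have hS := sDim_eq hqi H hrep
  simp only [hL] at hr hr'
  have hk : ∀ k, ∑ j ∈ Finset.range (k + 2),
      (-1 : ℤ) ^ j * (lam q M j * lam q (Msh q M) (k + 1 - j)) = 0 := fun k => by
    refine Int.cast_injective (α := K) ?_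
    have := koszul hqi H k
    push_cast
    exact this
  have hb := s_bound hq hqi H hn1 (Fintype.card_fin n) hr (hr' (n + 1) (by omega))
  have h1 := comb_lam hn1 (lam_zero M) ((lam_one M).trans (Fintype.card_fin n)) hr'
    (lam_zero (Msh q M)) hk hb
  refine ⟨fun k => (hL k).trans (h1 k), fun k => (hS k).trans ?_⟩
  exact comb_s hn1 h1 (lam_zero (Msh q M)) hk k

end HeckeProof

/-- Corollary 3.3 (first part): if `R` is an even Hecke operator whose rank equals
`n = dim V`, then `P_Λ(t) = (1+t)^n` and `P_S(t) = (1−t)^{−n}`, i.e. `λ_k = C(n,k)`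
and `s_k = C(n+k−1,k)` for all `k`. -/
theorem even_hecke_rank_eq_dim_poincare
    (K : Type*) [Field K] [CharZero K] (V : Type*) [AddCommGroup V] [Module K V]
    [FiniteDimensional K V] (q : K) (hq : q ≠ 0)
    (R : V ⊗[K] V →ₗ[K] V ⊗[K] V) (hR : IsHecke K V q R)
    (hqint : ∀ k : ℕ, 1 ≤ k → (∑ i ∈ Finset.range k, q ^ i) ≠ 0)
    (n : ℕ) (hn : n = Module.finrank K V)
    (hr : lambdaDim K V R n = 1) (hr' : ∀ k, n < k → lambdaDim K V R k = 0) :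
    (∀ k, lambdaDim K V R k = n.choose k) ∧
      (∀ k, sDim K V q R k = (n + k - 1).choose k) := by
  rcases Nat.eq_zero_or_pos n with h0 | hn1
  · subst h0
    haveI : Subsingleton V := Module.finrank_zero_iff.mp hn.symm
    have hW : ∀ f g : V ⊗[K] V →ₗ[K] V ⊗[K] V, f = g := fun f g =>
      TensorProduct.ext' fun x y => by rw [Subsingleton.elim x 0, TensorProduct.zero_tmul]; simp
    have hS : ∀ k, sDim K V q R k = lambdaDim K V R k := fun k => by
      rw [sDim, lambdaDim, hW (R - q • LinearMap.id) (R + LinearMap.id)]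
    have hL : ∀ k, lambdaDim K V R k = (0 : ℕ).choose k := fun k => by
      rcases k with _ | k
      · simpa using hr
      · simpa using hr' (k + 1) (by omega)
    refine ⟨hL, fun k => ?_⟩
    rw [hS, hL]
    rcases k with _ | k
    · simp
    · rw [Nat.choose_eq_zero_of_lt (by omega), Nat.choose_eq_zero_of_lt (by omega)]
  · exact HeckeProof.main_pos K V q hq R hR hqint n hn1 hn hr hr'
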